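/- arXiv:2604.07688 — 5 statements merged into one kernel-verified Lean document; each statement's English description precedes it below -/
import Mathlib

section
/- Let B be a unital C*-algebra, a ∈ B, and (p_i)_{i∈ℕ} a sequence of nonzero mutually orthogonal projections in B satisfying conditions (1)–(4). Then p_i ∈ C*({a}) for every i ∈ ℕ, where C*({a}) is the smallest norm-closed *-subalgebra of B containing a. -/
/-- The smallest norm-closed star-subalgebra of `B` containing `S`. -/
def cstarGen {B : Type*} [NonUnitalCStarAlgebra B] (S : Set B) : Set B :=
  closure ((NonUnitalStarAlgebra.adjoin ℂ S : NonUnitalStarSubalgebra ℂ B) : Set B)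

/-- `x` is invertible in the corner algebra `pBp` (with unit `p`). -/
def cornerInvertible {B : Type*} [CStarAlgebra B] (p x : B) : Prop :=
  ∃ y : B, p * y * p = y ∧ x * y = p ∧ y * x = p

/-- The spectrum of `x ∈ pBp` in the unital algebra `pBp` (with unit `p`). -/
def cornerSpectrum {B : Type*} [CStarAlgebra B] (p x : B) : Set ℂ :=
  {z : ℂ | ¬ cornerInvertible p (x - z • p)}

open MeasureTheory Filter Topology

section Riesz

variable {B : Type*} [CStarAlgebra B]

lemma integral_mem_closed {S : Submodule ℝ B} (hS : IsClosed (S : Set B)) (f : ℂ → B)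
    (hf : ∀ z, f z ∈ S) (hi : Integrable f) : ∫ z, f z ∈ S := by
  have : IsClosed (S : Set B) := hS
  have h := S.mkQL.integral_comp_comm hi
  rw [← Submodule.Quotient.mk_eq_zero]
  have h2 : ∀ z, S.mkQL (f z) = 0 := fun z => by
    simpa using hf z
  simp only [h2, integral_zero] at h
  simpa using h.symm

/-- twice the d-bar derivative -/
noncomputable def dbr (φ : ℂ → ℂ) (z : ℂ) : ℂ := fderiv ℝ φ z 1 + Complex.I * fderiv ℝ φ z Complex.I

lemma dbr_cont {φ : ℂ → ℂ} (hφ : ContDiff ℝ 1 φ) : Continuous (dbr φ) := by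
  have h := hφ.continuous_fderiv one_ne_zero
  unfold dbr
  fun_prop

lemma dbr_tsupport (φ : ℂ → ℂ) : tsupport (dbr φ) ⊆ tsupport φ := by
  refine closure_minimal (fun z hz => ?_) (isClosed_tsupport _)
  by_contra hn
  have : fderiv ℝ φ z = 0 := by
    by_contra h
    exact hn (support_fderiv_subset ℝ h)
  simp [dbr, this] at hz

lemma integrable_smul_of (g : ℂ → ℂ) (h : ℂ → B) (U : Set ℂ) (hU : IsOpen U) (hg : Continuous g)
    (hc : HasCompactSupport g) (hs : tsupport g ⊆ U) (hh : ContinuousOn h U) :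
    Integrable (fun z => g z • h z) := by
  have hc' : HasCompactSupport (fun z => g z • h z) := hc.smul_right
  refine Continuous.integrable_of_hasCompactSupport ?_ hc'
  refine (hg.continuousOn.smul hh).continuous_of_tsupport_subset hU ?_
  exact (tsupport_smul_subset_left g h).trans hs

lemma resolvent_contOn (y : B) : ContinuousOn (resolvent y) (resolventSet ℂ y) := fun _ hz =>
  (spectrum.hasDerivAt_resolvent_const_left hz).continuousAt.continuousWithinAt

lemma dbr_integrable (y : B) {φ : ℂ → ℂ} (hφ : ContDiff ℝ 1 φ) (hc : HasCompactSupport φ)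
    (hs : tsupport (dbr φ) ⊆ resolventSet ℂ y) :
    Integrable (fun z => dbr φ z • resolvent y z) :=
  integrable_smul_of _ _ _ (spectrum.isOpen_resolventSet y) (dbr_cont hφ)
    (hc.mono' ((subset_tsupport _).trans (dbr_tsupport φ))) hs (resolvent_contOn y)

lemma dbr_integral_zero (y : B) {φ : ℂ → ℂ} (hφ : ContDiff ℝ 1 φ) (hc : HasCompactSupport φ)
    (hs : tsupport φ ⊆ resolventSet ℂ y) :
    ∫ z, dbr φ z • resolvent y z = 0 := by
  have hd : ∀ z ∈ resolventSet ℂ y, HasFDerivAt (𝕜 := ℝ) (resolvent y)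
      ((ContinuousLinearMap.toSpanSingleton ℂ (-resolvent y z ^ 2)).restrictScalars ℝ) z := fun z hz =>
    (spectrum.hasDerivAt_resolvent_const_left hz).hasFDerivAt.restrictScalars ℝ
  have hcf : HasCompactSupport (fderiv ℝ φ) := hc.fderiv ℝ
  have hfc := hφ.continuous_fderiv one_ne_zero
  have hO := spectrum.isOpen_resolventSet (𝕜 := ℂ) y
  have hr := resolvent_contOn y
  have hts : ∀ v, tsupport (fun z => fderiv ℝ φ z v) ⊆ tsupport φ := fun v => by
    refine (closure_mono ?_).trans (tsupport_fderiv_subset ℝ)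
    intro z hz h
    simp [h] at hz
  have hI1 : ∀ v, Integrable (fun z => fderiv ℝ φ z v • resolvent y z) := fun v =>
    integrable_smul_of _ _ _ hO (by fun_prop)
      (hc.mono' ((subset_tsupport _).trans (hts v))) ((hts v).trans hs) hr
  have hI2 : ∀ v, Integrable (fun z => φ z • fderiv ℝ (resolvent y) z v) := fun v => by
    refine integrable_smul_of _ _ _ hO hφ.continuous hc hs ?_
    have : ContinuousOn (fun z => v • (-resolvent y z ^ 2)) (resolventSet ℂ y) := by fun_prop
    refine this.congr fun z hz => ?_
    rw [(hd z hz).fderiv]; simp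
  have key : ∀ v, ∫ z, fderiv ℝ φ z v • resolvent y z
      = - ∫ z, φ z • fderiv ℝ (resolvent y) z v := fun v => by
    rw [integral_smul_fderiv_eq_neg_fderiv_smul_of_integrable (hI1 v) (hI2 v), neg_neg]
    · exact integrable_smul_of _ _ _ hO hφ.continuous hc hs hr
    · exact fun x _ => (hφ.differentiable one_ne_zero) x
    · exact fun x hx => (hd x (hs hx)).differentiableAt
  have e1 : ∀ z, dbr φ z • resolvent y z = fderiv ℝ φ z 1 • resolvent y z
      + Complex.I • (fderiv ℝ φ z Complex.I • resolvent y z) := fun z => by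
    rw [dbr, add_smul, mul_smul]
  simp_rw [e1]
  have e2 : Integrable (fun z => Complex.I • (fderiv ℝ φ z Complex.I • resolvent y z)) :=
    (hI1 Complex.I).smul Complex.I
  have e3 : Integrable (fun z => Complex.I • (φ z • fderiv ℝ (resolvent y) z Complex.I)) :=
    (hI2 Complex.I).smul Complex.I
  rw [integral_add (hI1 1) e2, integral_smul, key, key,
    smul_neg, ← neg_add, ← integral_smul, ← integral_add (hI2 1) e3,
    neg_eq_zero, ← integral_zero ℂ B]
  congr 1
  ext z
  by_cases hz : z ∈ tsupport φ
  · rw [(hd z (hs hz)).fderiv]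
    simp [smul_smul]
    rw [mul_comm (φ z), ← mul_assoc]
    simp
  · simp [image_eq_zero_of_notMem_tsupport hz]

/-! explicit radial cutoffs -/

noncomputable def chi (R : ℝ) (z : ℂ) : ℂ := (Real.smoothTransition (2 - Complex.normSq z / R ^ 2) : ℝ)

lemma normSq_contDiff : ContDiff ℝ 1 (fun z : ℂ => Complex.normSq z) := by
  simp_rw [Complex.normSq_apply]
  have h1 : ContDiff ℝ 1 Complex.re := Complex.reCLM.contDiff
  have h2 : ContDiff ℝ 1 Complex.im := Complex.imCLM.contDiff
  fun_prop

lemma chi_contDiff (R : ℝ) : ContDiff ℝ 1 (chi R) := by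
  unfold chi
  have := normSq_contDiff
  have h2 : ContDiff ℝ 1 Real.smoothTransition := Real.smoothTransition.contDiff
  refine Complex.ofRealCLM.contDiff.comp (h2.comp (f := fun z : ℂ => 2 - Complex.normSq z / R ^ 2) ?_)
  fun_prop

lemma chi_dbr (R : ℝ) (z : ℂ) : dbr (chi R) z =
    (-2 / R ^ 2 * deriv Real.smoothTransition (2 - Complex.normSq z / R ^ 2) : ℝ) * z := by
  have hd : HasDerivAt Real.smoothTransition
      (deriv Real.smoothTransition (2 - Complex.normSq z / R ^ 2)) (2 - Complex.normSq z / R ^ 2) :=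
    ((Real.smoothTransition.contDiff (n := 1)).differentiable (by simp) _).hasDerivAt
  set c := deriv Real.smoothTransition (2 - Complex.normSq z / R ^ 2)
  have hn : HasFDerivAt (fun z : ℂ => 2 - Complex.normSq z / R ^ 2)
      (-(((z.re • Complex.reCLM + z.re • Complex.reCLM) + (z.im • Complex.imCLM + z.im • Complex.imCLM)).smulRight (R ^ 2)⁻¹) : ℂ →L[ℝ] ℝ) z := by
    have h1 : HasFDerivAt Complex.re Complex.reCLM z := Complex.reCLM.hasFDerivAt
    have h2 : HasFDerivAt Complex.im Complex.imCLM z := Complex.imCLM.hasFDerivAt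
    have h3 := ((h1.mul h1).add (h2.mul h2)).mul_const (R ^ 2)⁻¹
    refine (h3.const_sub 2).congr_fderiv ?_ |>.congr_of_eventuallyEq ?_
    · ext <;> simp <;> ring
    · filter_upwards with w
      simp [Complex.normSq_apply, div_eq_mul_inv]
  have hc := (hd.hasFDerivAt.comp z hn)
  have hc2 : HasFDerivAt (chi R) _ z := Complex.ofRealCLM.hasFDerivAt.comp z hc
  rw [dbr, hc2.fderiv]
  simp
  linear_combination (-2 / (R:ℂ) ^ 2 * c) * Complex.re_add_im z


noncomputable def kk (R : ℝ) (z : ℂ) : ℝ :=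
  -2 / R ^ 2 * deriv Real.smoothTransition (2 - Complex.normSq z / R ^ 2)

lemma kk_zero {R : ℝ} (hR : 0 < R) {z : ℂ} (hz : ‖z‖ < R) : kk R z = 0 := by
  have h1 : 1 < 2 - Complex.normSq z / R ^ 2 := by
    have : Complex.normSq z / R ^ 2 < 1 := by
      rw [div_lt_one (by positivity), Complex.normSq_eq_norm_sq]
      gcongr
    linarith
  have h2 : Real.smoothTransition =ᶠ[𝓝 (2 - Complex.normSq z / R ^ 2)] fun _ => 1 := by
    filter_upwards [lt_mem_nhds h1] with t ht
    exact Real.smoothTransition.one_of_one_le ht.le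
  rw [kk, h2.deriv_eq]; simp

lemma chi_one {R : ℝ} (hR : 0 < R) {z : ℂ} (hz : ‖z‖ < R) : chi R z = 1 := by
  have h1 : 1 ≤ 2 - Complex.normSq z / R ^ 2 := by
    have : Complex.normSq z / R ^ 2 < 1 := by
      rw [div_lt_one (by positivity), Complex.normSq_eq_norm_sq]
      gcongr
    linarith
  simp [chi, Real.smoothTransition.one_of_one_le h1]

lemma chi_compact {R : ℝ} (hR : 0 < R) : HasCompactSupport (chi R) := by
  refine HasCompactSupport.intro (isCompact_closedBall 0 (2 * R)) fun z hz => ?_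
  have hz : 2 * R < ‖z‖ := by simpa using hz
  have : 2 - Complex.normSq z / R ^ 2 ≤ 0 := by
    rw [sub_nonpos, le_div_iff₀ (by positivity), Complex.normSq_eq_norm_sq]
    nlinarith
  simp [chi, Real.smoothTransition.zero_of_nonpos this]

lemma deriv_st_cont : Continuous (deriv Real.smoothTransition) :=
  (Real.smoothTransition.contDiff (n := 1)).continuous_deriv (by simp)

lemma kk_cont (R : ℝ) : Continuous (kk R) := by
  have h1 := deriv_st_cont
  have h2 := normSq_contDiff.continuous
  unfold kk
  fun_prop

lemma kk_compact {R : ℝ} (hR : 0 < R) : HasCompactSupport (kk R) := by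
  refine HasCompactSupport.intro (isCompact_closedBall 0 (2 * R)) fun z hz => ?_
  have hz : 2 * R < ‖z‖ := by simpa using hz
  have : 2 - Complex.normSq z / R ^ 2 < 0 := by
    rw [sub_neg, lt_div_iff₀ (by positivity), Complex.normSq_eq_norm_sq]
    nlinarith
  have h2 : Real.smoothTransition =ᶠ[𝓝 (2 - Complex.normSq z / R ^ 2)] fun _ => 0 := by
    filter_upwards [gt_mem_nhds this] with t ht
    exact Real.smoothTransition.zero_of_nonpos ht.le
  rw [kk, h2.deriv_eq]; simp

lemma kk_integrable {R : ℝ} (hR : 0 < R) : Integrable (kk R) :=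
  (kk_cont R).integrable_of_hasCompactSupport (kk_compact hR)

lemma kk_nonpos (R : ℝ) (z : ℂ) : kk R z ≤ 0 := by
  have : 0 ≤ deriv Real.smoothTransition (2 - Complex.normSq z / R ^ 2) :=
    Real.smoothTransition.monotone.deriv_nonneg
  have h2 : -2 / R ^ 2 ≤ 0 := div_nonpos_of_nonpos_of_nonneg (by norm_num) (by positivity)
  exact mul_nonpos_of_nonpos_of_nonneg h2 this

lemma kk_integral {R : ℝ} (hR : 0 < R) : ∫ z, kk R z = ∫ z, kk 1 z := by
  have h := Measure.integral_comp_smul (volume : Measure ℂ) (kk 1) R⁻¹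
  have h2 : ∀ z, kk R z = (R ^ 2)⁻¹ * kk 1 (R⁻¹ • z) := fun z => by
    have : Complex.normSq (R⁻¹ • z) / 1 ^ 2 = Complex.normSq z / R ^ 2 := by
      simp [Complex.normSq_mul]; field_simp
    rw [kk, kk, this]; ring
  simp_rw [h2]
  rw [integral_const_mul, h]
  simp
  field_simp

lemma kk_ne : ∫ z, kk 1 z ≠ 0 := by
  intro h
  have h1 : ∫ z, - kk 1 z = 0 := by rw [integral_neg, h, neg_zero]
  replace h1 := (integral_eq_zero_iff_of_nonneg (f := fun z => - kk 1 z)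
    (fun z => by simpa using kk_nonpos 1 z) (kk_integrable one_pos).neg).1 h1
  have h2 : (fun z => - kk 1 z) = 0 := (kk_cont 1).neg.ae_eq_iff_eq volume continuous_zero |>.1 h1
  have h3 : ∀ t ∈ Set.Icc (0:ℝ) 1, deriv Real.smoothTransition t = 0 := by
    intro t ht
    have h4 := congrFun h2 (Real.sqrt (2 - t) : ℝ)
    simp only [kk, Complex.normSq_ofReal, Pi.zero_apply] at h4
    rw [Real.mul_self_sqrt (by linarith [ht.2])] at h4
    simpa using h4
  have hdiff : Differentiable ℝ Real.smoothTransition :=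
    (Real.smoothTransition.contDiff (n := 1)).differentiable (by simp)
  obtain ⟨t, ht, he⟩ := exists_deriv_eq_slope Real.smoothTransition (zero_lt_one)
    hdiff.continuous.continuousOn hdiff.differentiableOn
  rw [h3 t ⟨ht.1.le, ht.2.le⟩] at he
  simp at he

lemma dbr_integral_one (b : B) {φ : ℂ → ℂ} (hφ : ContDiff ℝ 1 φ) (hc : HasCompactSupport φ)
    (h1 : ∀ᶠ z in 𝓝ˢ (spectrum ℂ b), φ z = 1)
    (hs : tsupport (dbr φ) ⊆ resolventSet ℂ b) :
    ∫ z, dbr φ z • resolvent b z = (∫ z, kk 1 z) • (1 : B) := by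
  -- compare with chi R for large R
  rw [← sub_eq_zero, ← norm_le_zero_iff]
  refine le_of_forall_pos_le_add fun ε hε => ?_
  have hev : ∀ᶠ z in Bornology.cobounded ℂ, ‖b‖ * ‖resolvent b z‖ < ε / (1 + ∫ z, - kk 1 z) := by
    have : Tendsto (fun z : ℂ => ‖b‖ * ‖resolvent b z‖) (Bornology.cobounded ℂ) (𝓝 0) := by
      simpa using (spectrum.resolvent_tendsto_cobounded (𝕜 := ℂ) b).norm.const_mul ‖b‖
    refine this.eventually (gt_mem_nhds ?_)
    have : 0 ≤ ∫ z, - kk 1 z := integral_nonneg fun z => by simpa using kk_nonpos 1 z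
    positivity
  have hI : 0 ≤ ∫ z, - kk 1 z := integral_nonneg fun z => by simpa using kk_nonpos 1 z
  rw [hasBasis_cobounded_norm.eventually_iff] at hev
  obtain ⟨r, -, hr⟩ := hev
  obtain ⟨R, hR⟩ : ∃ R, R = max (max r (‖b‖ * ‖(1:B)‖ + 1)) 1 := ⟨_, rfl⟩
  have hR0 : 0 < R := by rw [hR]; exact lt_max_of_lt_right one_pos
  have hRr : r ≤ R := by rw [hR]; exact (le_max_left _ _).trans (le_max_left _ _)
  have hRb : ‖b‖ * ‖(1:B)‖ < R := by
    rw [hR]; exact (lt_add_one _).trans_le ((le_max_right _ _).trans (le_max_left _ _))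
  have hout : ∀ z : ℂ, R ≤ ‖z‖ → z ∈ resolventSet ℂ b := fun z hz =>
    spectrum.mem_resolventSet_of_norm_lt_mul (hRb.trans_le hz)
  have hdc : ∀ z, dbr (chi R) z = kk R z * z := fun z => chi_dbr R z
  have hsc : tsupport (dbr (chi R)) ⊆ resolventSet ℂ b := by
    refine (closure_minimal (t := {z : ℂ | R ≤ ‖z‖}) (fun z hz => ?_)
      (isClosed_le continuous_const continuous_norm)).trans hout
    by_contra hn
    exact hz (by rw [hdc, kk_zero hR0 (not_le.1 hn)]; simp)
  have hchi := chi_contDiff R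
  have hsub : ∀ z, dbr (φ - chi R) z = dbr φ z - dbr (chi R) z := fun z => by
    simp only [dbr]
    rw [fderiv_sub (hφ.differentiable one_ne_zero z) (hchi.differentiable one_ne_zero z)]
    simp; ring
  have hz0 : ∫ z, dbr (φ - chi R) z • resolvent b z = 0 := by
    refine dbr_integral_zero b (hφ.sub hchi) (hc.sub (chi_compact hR0)) ?_
    intro z hz
    by_contra hn
    have hn' : z ∈ spectrum ℂ b := hn
    rw [eventually_nhdsSet_iff_forall] at h1
    have h2 := h1 z hn'
    have hzR : ‖z‖ < R := not_le.1 fun h => hn (hout z h)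
    have h3 : ∀ᶠ w : ℂ in 𝓝 z, ‖w‖ < R := (continuous_norm.tendsto z).eventually (gt_mem_nhds hzR)
    refine absurd hz (notMem_tsupport_iff_eventuallyEq.2 ?_)
    filter_upwards [h2, h3] with w hw hw'
    simp [hw, chi_one hR0 hw']
  have hi1 := dbr_integrable b hφ hc hs
  have hi2 := dbr_integrable b hchi (chi_compact hR0) hsc
  simp_rw [hsub, sub_smul] at hz0
  rw [integral_sub hi1 hi2, sub_eq_zero] at hz0
  rw [hz0, ← kk_integral hR0, ← integral_smul_const,
    ← integral_sub hi2 ((kk_integrable hR0).smul_const 1)]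
  have hb := norm_integral_le_of_norm_le (μ := volume)
    (f := fun z => dbr (chi R) z • resolvent b z - kk R z • (1:B))
    (g := fun z => (- kk R z) * (ε / (1 + ∫ z, - kk 1 z)))
    ((kk_integrable hR0).neg.mul_const _) (ae_of_all _ fun z => ?_)
  · refine hb.trans ?_
    rw [integral_mul_const, integral_neg, kk_integral hR0, ← integral_neg, zero_add, mul_div_assoc',
      div_le_iff₀ (by positivity)]
    nlinarith
  · rw [hdc]
    rcases lt_or_ge ‖z‖ R with hz | hz
    · simp [kk_zero hR0 hz]
    · have h5 : ((kk R z : ℂ) * z) • resolvent b z - kk R z • (1:B)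
          = (kk R z : ℂ) • (b * resolvent b z) := by
        have h6 : (algebraMap ℂ B z - b) * resolvent b z = 1 :=
          Ring.mul_inverse_cancel _ (hout z hz)
        rw [sub_mul, ← Algebra.smul_def, sub_eq_iff_eq_add] at h6
        rw [mul_smul, h6, smul_add, Complex.coe_smul, Complex.coe_smul]
        abel
      rw [h5, norm_smul]
      have : ‖(kk R z : ℂ)‖ = - kk R z := by
        rw [Complex.norm_real, Real.norm_of_nonpos (kk_nonpos R z)]
      rw [this]
      refine mul_le_mul_of_nonneg_left ?_ (by simpa using kk_nonpos R z)
      exact (norm_mul_le _ _).trans (hr (hRr.trans hz)).le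

end Riesz
section Alg
variable {B : Type*} [CStarAlgebra B]

lemma two_block {p q x : B} (hp : p * p = p) (hq : q * q = q) (hpq : p * q = 0)
    (hqp : q * p = 0) (hx : q * x * p = 0) (hP : cornerInvertible p (p * x * p))
    (hQ : cornerInvertible q (q * x * q)) :
    cornerInvertible (p + q) ((p + q) * x * (p + q)) := by
  obtain ⟨y, hy, hy1, hy2⟩ := hP
  obtain ⟨w, hw, hw1, hw2⟩ := hQ
  have e1 : p * y = y := by rw [← hy]; simp only [← mul_assoc, hp]
  have e2 : y * p = y := by rw [← hy]; simp only [mul_assoc, hp]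
  have e3 : q * w = w := by rw [← hw]; simp only [← mul_assoc, hq]
  have e4 : w * q = w := by rw [← hw]; simp only [mul_assoc, hq]
  have e5 : q * y = 0 := by rw [← e1, ← mul_assoc, hqp, zero_mul]
  have e6 : y * q = 0 := by rw [← e2, mul_assoc, hpq, mul_zero]
  have e7 : p * w = 0 := by rw [← e3, ← mul_assoc, hpq, zero_mul]
  have e8 : w * p = 0 := by rw [← e4, mul_assoc, hqp, mul_zero]
  obtain ⟨A, hA⟩ : ∃ A, A = p * x * p := ⟨_, rfl⟩
  obtain ⟨C, hC⟩ : ∃ C, C = p * x * q := ⟨_, rfl⟩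
  obtain ⟨D, hD⟩ : ∃ D, D = q * x * q := ⟨_, rfl⟩
  have hX : (p + q) * x * (p + q) = A + C + D := by
    rw [hA, hC, hD, add_mul, add_mul, mul_add, mul_add, hx]; abel
  rw [hX]
  rw [← hA] at hy1 hy2
  rw [← hD] at hw1 hw2
  have f1 : A * w = 0 := by rw [hA, mul_assoc, e7, mul_zero]
  have f2 : C * y = 0 := by rw [hC, mul_assoc, e5, mul_zero]
  have f3 : D * y = 0 := by rw [hD, mul_assoc, e5, mul_zero]
  have f4 : y * D = 0 := by rw [hD, mul_assoc, ← mul_assoc, e6, zero_mul]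
  have f5 : w * A = 0 := by rw [hA, mul_assoc, ← mul_assoc, e8, zero_mul]
  have f6 : w * C = 0 := by rw [hC, mul_assoc, ← mul_assoc, e8, zero_mul]
  have f7 : p * C = C := by rw [hC, ← mul_assoc, ← mul_assoc, hp]
  have f8 : C * q = C := by rw [hC, mul_assoc, hq]
  refine ⟨y + w - y * C * w, ?_, ?_, ?_⟩
  · have g1 : (p + q) * (y + w - y * C * w) = y + w - y * C * w := by
      simp only [add_mul, mul_add, mul_sub, ← mul_assoc, e1, e3, e5, e7]
      simp
    have g2 : (y + w - y * C * w) * (p + q) = y + w - y * C * w := by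
      simp only [add_mul, mul_add, sub_mul, mul_assoc, e2, e4, e6, e8]
      simp
      abel
    rw [g1, g2]
  · simp only [add_mul, mul_add, mul_sub, ← mul_assoc, hy1, hw1, f1, f2, f3, f7]
    simp
    abel
  · simp only [add_mul, mul_add, sub_mul, mul_assoc, hy2, hw2, f4, f5, f6, f8]
    simp

lemma corner_to_res {p a : B} {μ z : ℂ} (hp : p * p = p) (hz : z ≠ μ)
    (h : cornerInvertible p (p * (a - z • 1) * p)) :
    z ∈ resolventSet ℂ (p * a * p + μ • (1 - p)) := by
  have e1 : p * (1 - p) = 0 := by rw [mul_sub, hp, mul_one, sub_self]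
  have e2 : (1 - p) * p = 0 := by rw [sub_mul, hp, one_mul, sub_self]
  have e3 : (1 - p) * (1 - p) = 1 - p := by rw [sub_mul, e1, one_mul, sub_zero]
  obtain ⟨y, hy, hy1, hy2⟩ := h
  have hpy : p * y = y := by rw [← hy]; simp only [← mul_assoc, hp]
  have hyp : y * p = y := by rw [← hy]; simp only [mul_assoc, hp]
  have hqy : (1 - p) * y = 0 := by rw [← hpy, ← mul_assoc, e2, zero_mul]
  have hyq : y * (1 - p) = 0 := by rw [← hyp, mul_assoc, e1, mul_zero]
  have hX : algebraMap ℂ B z - (p * a * p + μ • (1 - p))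
      = -(p * (a - z • 1) * p) + (z - μ) • (1 - p) := by
    rw [Algebra.algebraMap_eq_smul_one]
    simp only [mul_sub, sub_mul, mul_smul_comm, smul_mul_assoc, mul_one, hp]
    module
  have hzm : z - μ ≠ 0 := sub_ne_zero.2 hz
  refine spectrum.mem_resolventSet_of_left_right_inverse (b := -y + (z - μ)⁻¹ • (1 - p))
    (c := -y + (z - μ)⁻¹ • (1 - p)) ?_ ?_
  · have f1 : p * (a - z • 1) * p * (1 - p) = 0 := by rw [mul_assoc, e1, mul_zero]
    rw [hX]
    simp only [add_mul, mul_add, neg_mul_neg, hy1, smul_mul_assoc, mul_smul_comm, e3, neg_mul,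
      mul_neg, f1, hqy, smul_smul, mul_inv_cancel₀ hzm, inv_mul_cancel₀ hzm]
    simp
    rw [inv_smul_smul₀ hzm]
    abel
  · have f1 : (1 - p) * (p * (a - z • 1) * p) = 0 := by
      rw [mul_assoc, ← mul_assoc, e2, zero_mul]
    rw [hX]
    simp only [add_mul, mul_add, neg_mul_neg, hy2, smul_mul_assoc, mul_smul_comm, e3, neg_mul,
      mul_neg, f1, hyq, smul_smul, mul_inv_cancel₀ hzm, inv_mul_cancel₀ hzm]
    simp
    rw [smul_inv_smul₀ hzm]
    abel

/-- If `z` is in the resolvent set of `pap + μ(1-p)` then `p(a-z)p` is invertible in the corner. -/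
lemma res_to_corner {p a : B} {μ z : ℂ} (hp : p * p = p)
    (h : z ∈ resolventSet ℂ (p * a * p + μ • (1 - p))) :
    cornerInvertible p (p * (a - z • 1) * p) := by
  obtain ⟨X, hX⟩ : ∃ X, X = algebraMap ℂ B z - (p * a * p + μ • (1 - p)) := ⟨_, rfl⟩
  have e1 : p * (1 - p) = 0 := by rw [mul_sub, hp, mul_one, sub_self]
  have e2 : (1 - p) * p = 0 := by rw [sub_mul, hp, one_mul, sub_self]
  have h1 : X * p = - (p * (a - z • 1) * p) := by
    rw [hX, Algebra.algebraMap_eq_smul_one]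
    simp only [mul_sub, sub_mul, add_mul, mul_smul_comm, smul_mul_assoc, mul_one, one_mul, hp, mul_assoc]
    module
  have h2 : p * X = - (p * (a - z • 1) * p) := by
    rw [hX, Algebra.algebraMap_eq_smul_one]
    simp only [mul_sub, sub_mul, mul_add, mul_smul_comm, smul_mul_assoc, mul_one, one_mul, hp, ← mul_assoc]
    module
  have hu : IsUnit X := hX ▸ h
  obtain ⟨u, hu⟩ := hu
  obtain ⟨v, hv, hv1, hv2⟩ : ∃ v : B, v = ↑u⁻¹ ∧ X * v = 1 ∧ v * X = 1 :=
    ⟨_, rfl, by rw [← hu]; simp, by rw [← hu]; simp⟩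
  have hc : p * v = v * p := by
    calc p * v = v * X * (p * v) := by rw [hv2, one_mul]
      _ = v * (X * p) * v := by simp only [mul_assoc]
      _ = v * (p * X) * v := by rw [h1, h2]
      _ = v * p * (X * v) := by simp only [mul_assoc]
      _ = v * p := by rw [hv1, mul_one]
  refine ⟨-(p * v), ?_, ?_, ?_⟩
  · rw [mul_neg, neg_mul, ← mul_assoc, hp, mul_assoc, ← hc, ← mul_assoc, hp]
  · have : p * (a - z • 1) * p = -(p * X) := by rw [h2, neg_neg]
    rw [this, neg_mul_neg, hc, mul_assoc, ← mul_assoc X, hv1, one_mul, hp]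
  · have : p * (a - z • 1) * p = -(X * p) := by rw [h1, neg_neg]
    rw [this, neg_mul_neg, mul_assoc, ← mul_assoc v, hv2, one_mul, hp]

attribute [local instance] CStarAlgebra.spectralOrder CStarAlgebra.spectralOrderedRing

lemma proj_mem (A : NonUnitalStarSubalgebra ℂ B) (hA : IsClosed (A : Set B)) {P w u : B}
    (hP : IsSelfAdjoint P) (hPP : P * P = P) (hw : w ∈ A) (hPw : P * w = w) (hwu : w * u = P) :
    P ∈ A := by
  obtain ⟨h, hh⟩ : ∃ h, h = w * star w := ⟨_, rfl⟩
  have hhA : h ∈ A := hh ▸ mul_mem hw (star_mem hw)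
  have hPh : P * h = h := by rw [hh, ← mul_assoc, hPw]
  have hhP : h * P = h := by
    rw [hh, mul_assoc]
    congr 1
    nth_rewrite 2 [← hPw]
    rw [star_mul, hP.star_eq]
  have hP0 : 0 ≤ P := by
    have := star_mul_self_nonneg P
    rwa [hP.star_eq, hPP] at this
  have hPn : ‖P‖ ≤ 1 := IsStarProjection.norm_le P ⟨hPP, hP⟩
  have h0 : 0 ≤ h := hh ▸ mul_star_self_nonneg w
  have hle : h ≤ ‖h‖ • P := by
    have := CStarAlgebra.star_left_conjugate_le_norm_smul (a := P) (b := h) 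
    rwa [hP.star_eq, hPP, hPh, hhP] at this
  have hge : P ≤ ‖u * star u‖ • h := by
    have := CStarAlgebra.star_right_conjugate_le_norm_smul (a := w) (b := u * star u)
    have e : w * (u * star u) * star w = P := by
      rw [← mul_assoc, hwu, mul_assoc, ← star_mul, hwu, hP.star_eq, hPP]
    rwa [e, ← hh] at this
  obtain ⟨M, hM⟩ : ∃ M : ℝ, M = ‖h‖ + 1 := ⟨_, rfl⟩
  obtain ⟨K, hK⟩ : ∃ K : ℝ, K = ‖u * star u‖ + 1 := ⟨_, rfl⟩
  have hM1 : 1 ≤ M := by rw [hM]; linarith [norm_nonneg h]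
  have hK1 : 1 ≤ K := by rw [hK]; linarith [norm_nonneg (u * star u)]
  have hle' : M⁻¹ • h ≤ P := by
    have h1 : h ≤ M • P := hle.trans (smul_le_smul_of_nonneg_right (by linarith) hP0)
    have := smul_le_smul_of_nonneg_left h1 (inv_nonneg.2 (zero_le_one.trans hM1))
    rwa [smul_smul, inv_mul_cancel₀ (by positivity), one_smul] at this
  have hge' : (K⁻¹ * M⁻¹) • P ≤ M⁻¹ • h := by
    have h1 : P ≤ K • h := hge.trans (smul_le_smul_of_nonneg_right (by linarith) h0)
    have := smul_le_smul_of_nonneg_left h1 (a := K⁻¹ * M⁻¹) (by positivity)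
    refine this.trans_eq ?_
    rw [smul_smul]; congr 1; field_simp
  obtain ⟨t, ht⟩ : ∃ t : B, t = P - M⁻¹ • h := ⟨_, rfl⟩
  have ht1 : ‖t‖ < 1 := by
    have h1 : t ≤ (1 - K⁻¹ * M⁻¹) • P := by
      rw [ht, sub_smul, one_smul]; exact sub_le_sub_left hge' _
    have h2 : 0 ≤ t := ht ▸ sub_nonneg.2 hle'
    have h3 := CStarAlgebra.norm_le_norm_of_nonneg_of_le h2 h1
    refine h3.trans_lt ?_
    rw [norm_smul]
    have hk : 0 < K⁻¹ * M⁻¹ := by positivity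
    have hk1 : K⁻¹ * M⁻¹ ≤ 1 := by
      rw [← mul_inv]; exact inv_le_one_of_one_le₀ (one_le_mul_of_one_le_of_one_le hK1 hM1)
    rw [Real.norm_of_nonneg (by linarith)]
    nlinarith [norm_nonneg P]
  have hPt : P * t = t := by rw [ht, mul_sub, hPP, mul_smul_comm, hPh]
  have hmem : ∀ n : ℕ, P - t ^ (n + 1) ∈ A := by
    have hsm : ∀ x ∈ A, M⁻¹ • x ∈ A := fun x hx => by
      have := SMulMemClass.smul_mem ((M⁻¹ : ℝ) : ℂ) hx
      rwa [Complex.coe_smul] at this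
    have htP : t * P = t := by rw [ht, sub_mul, hPP, smul_mul_assoc, hhP]
    intro n
    induction n with
    | zero => simpa [ht] using hsm h hhA
    | succ n ih =>
      have e : P - t ^ (n + 1 + 1) = M⁻¹ • h + (P - t ^ (n + 1)) - M⁻¹ • (h * (P - t ^ (n + 1))) := by
        have : t ^ (n + 1) = P * t ^ (n + 1) := by rw [pow_succ', ← mul_assoc, hPt]
        have e3 : t ^ (n + 1 + 1) = t ^ (n + 1) - M⁻¹ • (h * t ^ (n + 1)) := by
          rw [pow_succ' t (n + 1)]
          nth_rewrite 1 [ht]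
          rw [sub_mul, ← this, smul_mul_assoc]
        rw [e3, mul_sub, hhP, smul_sub]; abel
      rw [e]
      exact sub_mem (add_mem (hsm h hhA) ih) (hsm _ (mul_mem hhA ih))
  refine hA.mem_of_tendsto (f := fun n : ℕ => P - t ^ (n + 1)) (b := atTop) ?_
    (Eventually.of_forall hmem)
  have := (tendsto_add_atTop_iff_nat 1).2 (tendsto_pow_atTop_nhds_zero_of_norm_lt_one ht1)
  simpa using this.const_sub P

end Alg
section Final
variable {B : Type*} [CStarAlgebra B]

lemma resolvent_mem (a : B) (z : ℂ) : resolvent a z ∈ StarAlgebra.elemental ℂ a := by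
  by_cases hz : z ∈ resolventSet ℂ a
  · have : IsClosed ((StarAlgebra.elemental ℂ a : StarSubalgebra ℂ B) : Set B) :=
      StarAlgebra.elemental.isClosed ℂ a
    obtain ⟨x, hx⟩ : ∃ x : StarAlgebra.elemental ℂ a, (x : B) = algebraMap ℂ B z - a :=
      ⟨algebraMap ℂ _ z - ⟨a, StarAlgebra.elemental.self_mem ℂ a⟩, rfl⟩
    have hu : IsUnit (x : B) := by rw [hx]; exact hz
    obtain ⟨v, hv⟩ := (StarSubalgebra.coe_isUnit _).1 hu
    have h1 : (x : B) * ((v⁻¹ : (StarAlgebra.elemental ℂ a)ˣ) : StarAlgebra.elemental ℂ a) = 1 := by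
      have : x * ((v⁻¹ : (StarAlgebra.elemental ℂ a)ˣ) : StarAlgebra.elemental ℂ a) = 1 := by
        rw [← hv]; simp
      exact congrArg Subtype.val this
    have h2 : resolvent a z * (x : B) = 1 := by
      rw [hx]; exact Ring.inverse_mul_cancel _ hz
    rw [left_inv_eq_right_inv h2 h1]
    exact Subtype.mem _
  · rw [spectrum.resolvent_zero_of_mem_spectrum hz]
    exact zero_mem _

lemma mul_elemental_mem (a e : B) (he : e ∈ StarAlgebra.elemental ℂ a) :
    a * e ∈ NonUnitalStarAlgebra.elemental ℂ a := by
  have hcl := NonUnitalStarAlgebra.elemental.isClosed ℂ a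
  have key : ∀ x ∈ StarAlgebra.adjoin ℂ ({a} : Set B),
      (∀ y ∈ NonUnitalStarAlgebra.elemental ℂ a, y * x ∈ NonUnitalStarAlgebra.elemental ℂ a) ∧
      (∀ y ∈ NonUnitalStarAlgebra.elemental ℂ a, x * y ∈ NonUnitalStarAlgebra.elemental ℂ a) := by
    intro x hx
    induction hx using StarAlgebra.adjoin_induction with
    | mem x hx =>
      obtain rfl : x = a := hx
      have := NonUnitalStarAlgebra.elemental.self_mem ℂ x
      exact ⟨fun y hy => mul_mem hy this, fun y hy => mul_mem this hy⟩
    | algebraMap r =>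
      refine ⟨fun y hy => ?_, fun y hy => ?_⟩
      · rw [← Algebra.commutes, ← Algebra.smul_def]; exact SMulMemClass.smul_mem r hy
      · rw [← Algebra.smul_def]; exact SMulMemClass.smul_mem r hy
    | add x y _ _ h1 h2 =>
      refine ⟨fun v hv => ?_, fun v hv => ?_⟩
      · rw [mul_add]; exact add_mem (h1.1 v hv) (h2.1 v hv)
      · rw [add_mul]; exact add_mem (h1.2 v hv) (h2.2 v hv)
    | mul x y _ _ h1 h2 =>
      refine ⟨fun v hv => ?_, fun v hv => ?_⟩
      · rw [← mul_assoc]; exact h2.1 _ (h1.1 v hv)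
      · rw [mul_assoc]; exact h1.2 _ (h2.2 v hv)
    | star x _ h1 =>
      refine ⟨fun v hv => ?_, fun v hv => ?_⟩
      · have := star_mem (h1.2 _ (star_mem hv)); simpa using this
      · have := star_mem (h1.1 _ (star_mem hv)); simpa using this
  have he' : e ∈ closure (StarAlgebra.adjoin ℂ ({a} : Set B) : Set B) := he
  have h := map_mem_closure (f := fun x => a * x)
    (t := (NonUnitalStarAlgebra.elemental ℂ a : Set B)) (by fun_prop) he'
    (fun x hx => (key x hx).1 a (NonUnitalStarAlgebra.elemental.self_mem ℂ a))
  rwa [hcl.closure_eq] at h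

lemma exists_cutoff {s t : Set ℂ} (hs : IsCompact s) (ht : IsCompact t) (hd : Disjoint s t) :
    ∃ φ : ℂ → ℂ, ContDiff ℝ 1 φ ∧ HasCompactSupport φ ∧ (∀ᶠ z in 𝓝ˢ s, φ z = 1) ∧
      ∀ᶠ z in 𝓝ˢ t, φ z = 0 := by
  obtain ⟨K, hK, hsK, hKt⟩ := exists_compact_between hs ht.isClosed.isOpen_compl
    hd.subset_compl_right
  obtain ⟨f, h0, h1, -⟩ := exists_contMDiffMap_zero_one_nhds_of_isClosed
    (modelWithCornersSelf ℝ ℂ) (n := 1) (isOpen_interior (s := K)).isClosed_compl hs.isClosed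
    (Set.disjoint_left.2 fun x hx hx' => hx (hsK hx'))
  have h0' : ∀ x ∉ interior K, f x = 0 := fun x hx => h0.self_of_nhdsSet x hx
  refine ⟨fun z => (f z : ℂ), ?_, ?_, ?_, ?_⟩
  · exact Complex.ofRealCLM.contDiff.comp f.contMDiff.contDiff
  · refine HasCompactSupport.intro hK fun x hx => ?_
    simp [h0' x (fun h => hx (interior_subset h))]
  · filter_upwards [h1] with z hz
    simp [hz]
  · have : Kᶜ ∈ 𝓝ˢ t := hK.isClosed.isOpen_compl.mem_nhdsSet.2 fun x hx hxK => hKt hxK hx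
    filter_upwards [this] with z hz
    simp [h0' z (fun h => hz (interior_subset h))]

lemma dbr_zero_of_const {φ : ℂ → ℂ} {c : ℂ} {s : Set ℂ} (h : ∀ᶠ z in 𝓝ˢ s, φ z = c) :
    tsupport (dbr φ) ⊆ sᶜ := by
  intro z hz hzs
  rw [eventually_nhdsSet_iff_forall] at h
  refine absurd hz (notMem_tsupport_iff_eventuallyEq.2 ?_)
  filter_upwards [(h z hzs).eventually_nhds] with w hw
  have : φ =ᶠ[𝓝 w] fun _ => c := hw
  simp [dbr, this.fderiv_eq]

lemma riesz (a b d P : B) (haP : a * P = P * b) (haQ : (1 - P) * a = d * (1 - P))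
    (hdisj : Disjoint (spectrum ℂ b) (spectrum ℂ d))
    (hres : ∀ z, z ∈ resolventSet ℂ b → z ∈ resolventSet ℂ d → z ∈ resolventSet ℂ a) :
    ∃ e ∈ StarAlgebra.elemental ℂ a, (1 - P) * e = 0 ∧ ∃ c : ℝ, c ≠ 0 ∧ e * P = c • P := by
  obtain ⟨φ, hφ, hc, h1, h0⟩ := exists_cutoff (spectrum.isCompact b) (spectrum.isCompact d) hdisj
  have hsb : tsupport (dbr φ) ⊆ resolventSet ℂ b := by
    simpa [spectrum] using dbr_zero_of_const h1
  have hsd : tsupport (dbr φ) ⊆ resolventSet ℂ d := by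
    simpa [spectrum] using dbr_zero_of_const h0
  have hsa : tsupport (dbr φ) ⊆ resolventSet ℂ a := fun z hz => hres z (hsb hz) (hsd hz)
  have hia := dbr_integrable a hφ hc hsa
  have hib := dbr_integrable b hφ hc hsb
  have hid := dbr_integrable d hφ hc hsd
  have hB := dbr_integral_one b hφ hc h1 hsb
  have hD : ∫ z, dbr φ z • resolvent d z = 0 := by
    refine dbr_integral_zero d hφ hc fun z hz => ?_
    by_contra hn
    rw [eventually_nhdsSet_iff_forall] at h0
    exact absurd hz (notMem_tsupport_iff_eventuallyEq.2 (h0 z hn))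
  have hcomm : ∀ z : ℂ, dbr φ z ≠ 0 → resolvent a z * P = P * resolvent b z ∧
      (1 - P) * resolvent a z = resolvent d z * (1 - P) := by
    intro z hz
    have hz' : z ∈ tsupport (dbr φ) := subset_tsupport _ hz
    have a1 : resolvent a z * (algebraMap ℂ B z - a) = 1 := Ring.inverse_mul_cancel _ (hsa hz')
    have a2 : (algebraMap ℂ B z - a) * resolvent a z = 1 := Ring.mul_inverse_cancel _ (hsa hz')
    have b2 : (algebraMap ℂ B z - b) * resolvent b z = 1 := Ring.mul_inverse_cancel _ (hsb hz')
    have d1 : resolvent d z * (algebraMap ℂ B z - d) = 1 := Ring.inverse_mul_cancel _ (hsd hz')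
    have e1 : (algebraMap ℂ B z - a) * P = P * (algebraMap ℂ B z - b) := by
      rw [sub_mul, mul_sub, haP, Algebra.commutes]
    have e2 : (1 - P) * (algebraMap ℂ B z - a) = (algebraMap ℂ B z - d) * (1 - P) := by
      rw [sub_mul _ _ (1 - P), mul_sub, haQ, Algebra.commutes]
    constructor
    · calc resolvent a z * P = resolvent a z * (P * ((algebraMap ℂ B z - b) * resolvent b z)) := by
            rw [b2, mul_one]
        _ = resolvent a z * (P * (algebraMap ℂ B z - b)) * resolvent b z := by
            simp only [mul_assoc]
        _ = resolvent a z * (algebraMap ℂ B z - a) * (P * resolvent b z) := by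
            rw [← e1]; simp only [mul_assoc]
        _ = _ := by rw [a1, one_mul]
    · calc (1 - P) * resolvent a z
          = resolvent d z * (algebraMap ℂ B z - d) * ((1 - P) * resolvent a z) := by
            rw [d1, one_mul]
        _ = resolvent d z * ((algebraMap ℂ B z - d) * (1 - P)) * resolvent a z := by
            simp only [mul_assoc]
        _ = resolvent d z * (1 - P) * ((algebraMap ℂ B z - a) * resolvent a z) := by
            rw [← e2]; simp only [mul_assoc]
        _ = _ := by rw [a2, mul_one]
  refine ⟨∫ z, dbr φ z • resolvent a z, ?_, ?_, ∫ z, kk 1 z, kk_ne, ?_⟩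
  · refine integral_mem_closed
      (S := (StarAlgebra.elemental ℂ a).toSubalgebra.toSubmodule.restrictScalars ℝ)
      (StarAlgebra.elemental.isClosed ℂ a) _ (fun z => ?_) hia
    exact SMulMemClass.smul_mem (S := StarSubalgebra ℂ B) (dbr φ z) (resolvent_mem a z)
  · rw [← integral_const_mul_of_integrable hia]
    have : ∀ z, (1 - P) * (dbr φ z • resolvent a z) = (dbr φ z • resolvent d z) * (1 - P) := by
      intro z
      by_cases hz : dbr φ z = 0
      · simp [hz]
      · rw [mul_smul_comm, (hcomm z hz).2, smul_mul_assoc]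
    simp_rw [this]
    rw [integral_mul_const_of_integrable hid, hD, zero_mul]
  · rw [← integral_mul_const_of_integrable hia]
    have : ∀ z, (dbr φ z • resolvent a z) * P = P * (dbr φ z • resolvent b z) := by
      intro z
      by_cases hz : dbr φ z = 0
      · simp [hz]
      · rw [mul_smul_comm, smul_mul_assoc, (hcomm z hz).1]
    simp_rw [this]
    rw [integral_const_mul_of_integrable hib, hB, mul_smul_comm, mul_one]

end Final

theorem proj_mem_cstarGen_singleton
    {B : Type*} [CStarAlgebra B] (a : B) (p : ℕ → B)
    (hsa : ∀ i, IsSelfAdjoint (p i)) (hidem : ∀ i, p i * p i = p i)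
    (hne : ∀ i, p i ≠ 0)
    (horth : ∀ i i', i ≠ i' → p i * p i' = 0)
    (h1 : ∀ n : ℕ,
      (1 - ∑ i ∈ Finset.range n, p i) * a * (∑ i ∈ Finset.range n, p i) = 0)
    (h2 : Filter.Tendsto
      (fun n : ℕ => ‖(1 - ∑ i ∈ Finset.range n, p i) * a * (1 - ∑ i ∈ Finset.range n, p i)‖)
      Filter.atTop (nhds 0))
    (h3 : ∀ i i', i ≠ i' →
      cornerSpectrum (p i) (p i * a * p i) ∩ cornerSpectrum (p i') (p i' * a * p i') = ∅)
    (h4 : ∀ i, cornerInvertible (p i) (p i * a * p i)) :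
    ∀ i : ℕ, p i ∈ cstarGen {a} := by
  -- the partial sums
  obtain ⟨P, hPdef⟩ : ∃ P : ℕ → B, P = fun n => ∑ i ∈ Finset.range n, p i := ⟨_, rfl⟩
  have hP : ∀ n, ∑ i ∈ Finset.range n, p i = P n := fun n => by rw [hPdef]
  simp only [hP] at h1 h2
  have hP0 : P 0 = 0 := by rw [← hP]; simp
  have hPs : ∀ n, P (n + 1) = P n + p n := fun n => by rw [← hP, ← hP, Finset.sum_range_succ]
  have hPp : ∀ n i, n ≤ i → P n * p i = 0 := fun n i hi => by
    rw [← hP, Finset.sum_mul]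
    exact Finset.sum_eq_zero fun j hj => horth j i (by have := Finset.mem_range.1 hj; omega)
  have hpP : ∀ n i, n ≤ i → p i * P n = 0 := fun n i hi => by
    rw [← hP, Finset.mul_sum]
    exact Finset.sum_eq_zero fun j hj => horth i j (by have := Finset.mem_range.1 hj; omega)
  have hPsa : ∀ n, IsSelfAdjoint (P n) := fun n => by
    rw [← hP]; exact isSelfAdjoint_sum _ fun i _ => hsa i
  have hPP : ∀ n, P n * P n = P n := by
    intro n
    induction n with
    | zero => simp [hP0]
    | succ n ih =>
      rw [hPs, add_mul, mul_add, mul_add, ih, hPp n n le_rfl, hpP n n le_rfl, hidem]; simp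
  have hPQ : ∀ n, P n * (1 - P n) = 0 := fun n => by rw [mul_sub, hPP, mul_one, sub_self]
  have hQP : ∀ n, (1 - P n) * P n = 0 := fun n => by rw [sub_mul, hPP, one_mul, sub_self]
  have hQQ : ∀ n, (1 - P n) * (1 - P n) = 1 - P n := fun n => by
    rw [sub_mul, hPQ, one_mul, sub_zero]
  have h1z : ∀ n (z : ℂ), (1 - P n) * (a - z • 1) * P n = 0 := fun n z => by
    rw [mul_sub, sub_mul, h1, mul_smul_comm, mul_one, smul_mul_assoc, hQP, smul_zero, sub_zero]
  have hcs : ∀ i z, z ∉ cornerSpectrum (p i) (p i * a * p i) →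
      cornerInvertible (p i) (p i * (a - z • 1) * p i) := fun i z hz => by
    have h : cornerInvertible (p i) (p i * a * p i - z • p i) := not_not.1 hz
    have e : p i * (a - z • 1) * p i = p i * a * p i - z • p i := by
      rw [mul_sub, sub_mul, mul_smul_comm, mul_one, smul_mul_assoc, hidem]
    rwa [e]
  have hup : ∀ n (z : ℂ), (∀ i < n, z ∉ cornerSpectrum (p i) (p i * a * p i)) →
      cornerInvertible (P n) (P n * (a - z • 1) * P n) := by
    intro n z hz
    induction n with
    | zero => exact ⟨0, by simp [hP0]⟩
    | succ n ih =>
      rw [hPs]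
      refine two_block (hPP n) (hidem n) (hPp n n le_rfl) (hpP n n le_rfl) ?_
        (ih fun i hi => hz i (by omega)) (hcs n z (hz n (by omega)))
      have e : p n = p n * (1 - P n) := by rw [mul_sub, hpP n n le_rfl, mul_one, sub_zero]
      rw [e, mul_assoc, mul_assoc, ← mul_assoc (1 - P n), h1z, mul_zero]
  have hdown : ∀ k n (z : ℂ), (∀ i, n ≤ i → z ∉ cornerSpectrum (p i) (p i * a * p i)) →
      cornerInvertible (1 - P (n + k)) ((1 - P (n + k)) * (a - z • 1) * (1 - P (n + k))) →
      cornerInvertible (1 - P n) ((1 - P n) * (a - z • 1) * (1 - P n)) := by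
    intro k
    induction k with
    | zero => intro n z _ h; exact h
    | succ k ih =>
      intro n z hz h
      have h' := ih (n + 1) z (fun i hi => hz i (by omega)) (by
        rwa [show n + 1 + k = n + (k + 1) by omega])
      have e : 1 - P n = p n + (1 - P (n + 1)) := by rw [hPs]; abel
      have ep : P (n + 1) * p n = p n := by
        rw [hPs, add_mul, hPp n n le_rfl, hidem, zero_add]
      have ep' : p n * P (n + 1) = p n := by
        rw [hPs, mul_add, hpP n n le_rfl, hidem, zero_add]
      rw [e]
      refine two_block (hidem n) (hQQ _) ?_ ?_ ?_ (hcs n z (hz n le_rfl)) h'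
      · rw [mul_sub, ep', mul_one, sub_self]
      · rw [sub_mul, ep, one_mul, sub_self]
      · rw [← ep, ← mul_assoc, h1z, zero_mul]
  have h0spec : ∀ i, (0 : ℂ) ∉ cornerSpectrum (p i) (p i * a * p i) := fun i h =>
    h (by simpa using h4 i)
  have hmain : ∀ n, P n ∈ NonUnitalStarAlgebra.elemental ℂ a := by
    intro n
    obtain ⟨d, hd⟩ : ∃ d, d = (1 - P n) * a * (1 - P n) := ⟨_, rfl⟩
    have hd' : d = (1 - P n) * a * (1 - P n) + (0 : ℂ) • (1 - (1 - P n)) := by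
      rw [hd, zero_smul, add_zero]
    obtain ⟨μ, hμ⟩ : ∃ μ : ℂ, μ ∈ resolventSet ℂ d := by
      refine ⟨((‖d‖ * ‖(1 : B)‖ + 1 : ℝ) : ℂ), spectrum.mem_resolventSet_of_norm_lt_mul ?_⟩
      rw [Complex.norm_real, Real.norm_of_nonneg (by positivity)]
      exact lt_add_one _
    obtain ⟨b, hb⟩ : ∃ b, b = P n * a * P n + μ • (1 - P n) := ⟨_, rfl⟩
    have haP : a * P n = P n * a * P n := by
      have := h1 n
      rw [sub_mul, sub_mul, one_mul, sub_eq_zero] at this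
      exact this
    have haPb : a * P n = P n * b := by
      rw [hb, mul_add, mul_smul_comm, hPQ, smul_zero, add_zero, ← mul_assoc, ← mul_assoc, hPP, haP]
    have haQ : (1 - P n) * a = d * (1 - P n) := by
      rw [hd, mul_assoc _ _ (1 - P n), hQQ, mul_sub, h1, mul_one, sub_zero]
    have hdisj : Disjoint (spectrum ℂ b) (spectrum ℂ d) := by
      rw [Set.disjoint_left]
      intro z hzb hzd
      have hzμ : z ≠ μ := fun h => hzd (h ▸ hμ)
      by_cases hall : ∀ i < n, z ∉ cornerSpectrum (p i) (p i * a * p i)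
      · exact hzb (by rw [hb]; exact corner_to_res (hPP n) hzμ (hup n z hall))
      · push Not at hall
        obtain ⟨i, hi, hzi⟩ := hall
        have hz0 : z ≠ 0 := fun h => h0spec i (h ▸ hzi)
        have hj : ∀ j, n ≤ j → z ∉ cornerSpectrum (p j) (p j * a * p j) := fun j hj hzj => by
          have : z ∈ (∅ : Set ℂ) := by
            rw [← h3 i j (by omega)]; exact ⟨hzi, hzj⟩
          exact this
        have h2' := h2.mul_const ‖(1 : B)‖
        rw [zero_mul] at h2'
        obtain ⟨N, hN⟩ := eventually_atTop.1 (h2'.eventually (gt_mem_nhds (norm_pos_iff.2 hz0)))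
        have hN' := hN (n + N) (by omega)
        have hr := spectrum.mem_resolventSet_of_norm_lt_mul hN'
        have hC : cornerInvertible (1 - P (n + N))
            ((1 - P (n + N)) * (a - z • 1) * (1 - P (n + N))) := by
          refine res_to_corner (μ := 0) (hQQ _) ?_
          rw [zero_smul, add_zero]; exact hr
        refine hzd ?_
        rw [hd']
        exact corner_to_res (hQQ n) hz0 (hdown N n z hj hC)
    have hres : ∀ z, z ∈ resolventSet ℂ b → z ∈ resolventSet ℂ d → z ∈ resolventSet ℂ a := by
      intro z hzb hzd
      rw [hb] at hzb
      rw [hd'] at hzd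
      have := two_block (hPP n) (hQQ n) (hPQ n) (hQP n) (h1z n z) (res_to_corner (hPP n) hzb)
        (res_to_corner (hQQ n) hzd)
      rw [add_sub_cancel] at this
      have h := corner_to_res (μ := z + 1) (mul_one 1) (by simp) this
      simpa using h
    obtain ⟨e, he, hQe, c, hc, heP⟩ := riesz a b d (P n) haPb haQ hdisj hres
    obtain ⟨y, hy, hy1, -⟩ := hup n 0 fun i _ => h0spec i
    rw [zero_smul, sub_zero] at hy1
    have hPy : P n * y = y := by rw [← hy]; simp only [← mul_assoc, hPP]
    refine proj_mem _ (NonUnitalStarAlgebra.elemental.isClosed ℂ a) (hPsa n) (hPP n)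
      (mul_elemental_mem a e he) (u := c⁻¹ • y) ?_ ?_
    · have : (1 - P n) * (a * e) = 0 := by rw [← mul_assoc, haQ, mul_assoc, hQe, mul_zero]
      rw [sub_mul, one_mul, sub_eq_zero] at this
      exact this.symm
    · rw [mul_smul_comm, ← hPy, mul_assoc, ← mul_assoc e, heP, smul_mul_assoc, mul_smul_comm,
        smul_smul, inv_mul_cancel₀ hc, one_smul, ← mul_assoc, haP, hy1]
  intro i
  have : p i = P (i + 1) - P i := by rw [hPs]; abel
  rw [this]
  exact sub_mem (hmain (i + 1)) (hmain i)
end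

section
/- Let B be a unital C*-algebra, a ∈ B, and (p_i)_{i∈ℕ} a sequence of nonzero mutually orthogonal projections in B satisfying conditions (1) and (2). Then for every n ∈ ℕ, σ_{(1−P_{n−1})B(1−P_{n−1})}((1 − P_{n−1}) a (1 − P_{n−1})) ⊆ (∪_{j=n}^{∞} σ_{p_j B p_j}(p_j a p_j)) ∪ {0}. -/
theorem corner_base {B : Type*} [CStarAlgebra B] [Nontrivial B] (q x : B) (z : ℂ)
    (hq : q * q = q) (hqx : q * x = x) (hxq : x * q = x) (hz : ‖x‖ < ‖z‖) :
    cornerInvertible q (x - z • q) := by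
  have hu : IsUnit (algebraMap ℂ B z - x) := spectrum.mem_resolventSet_of_norm_lt hz
  obtain ⟨u, hu⟩ := hu
  have e1 : x - z • q = - (q * (u : B)) := by
    rw [hu, mul_sub, hqx, Algebra.algebraMap_eq_smul_one, mul_smul_comm, mul_one]; abel
  have e2 : x - z • q = - ((u : B) * q) := by
    rw [hu, sub_mul, hxq, Algebra.algebraMap_eq_smul_one, smul_mul_assoc, one_mul]; abel
  have e3 : q * (u : B) = (u : B) * q := neg_injective (e1.symm.trans e2)
  refine ⟨-(q * (↑u⁻¹ : B) * q), ?_, ?_, ?_⟩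
  · rw [mul_neg, neg_mul]
    congr 1
    simp only [mul_assoc, hq]
    rw [← mul_assoc q q, hq]
  · rw [e2, neg_mul_neg, mul_assoc q _ q, mul_assoc, ← mul_assoc q q, hq, ← mul_assoc, ← e3,
      mul_assoc, ← mul_assoc (u : B), Units.mul_inv, one_mul, hq]
  · rw [e1, neg_mul_neg, mul_assoc, ← mul_assoc q q, hq, e3, mul_assoc,
      ← mul_assoc _ (u : B), Units.inv_mul, one_mul, hq]

theorem corner_step {B : Type*} [CStarAlgebra B] (p q a : B) (z : ℂ)
    (hp : p * p = p) (hq : q * q = q) (hpq : p * q = 0) (hqp : q * p = 0)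
    (h : q * a * p = 0)
    (h1 : cornerInvertible p (p * a * p - z • p))
    (h2 : cornerInvertible q (q * a * q - z • q)) :
    cornerInvertible (p + q) ((p + q) * a * (p + q) - z • (p + q)) := by
  obtain ⟨y, hy, hy1, hy2⟩ := h1
  obtain ⟨w, hw, hw1, hw2⟩ := h2
  have ex : (p + q) * a * (p + q) - z • (p + q)
      = (p * a * p - z • p) + (q * a * q - z • q) + p * a * q := by
    have : (p + q) * a * (p + q) = p * a * p + q * a * q + p * a * q + q * a * p := by
      noncomm_ring
    rw [this, h, smul_add]; abel
  rw [ex]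
  have hAp : (p * a * p - z • p) * p = p * a * p - z • p := by
    rw [sub_mul, mul_assoc _ p p, hp, smul_mul_assoc, hp]
  have hpA : p * (p * a * p - z • p) = p * a * p - z • p := by
    rw [mul_sub, ← mul_assoc, ← mul_assoc, hp, mul_smul_comm, hp]
  have hDq : (q * a * q - z • q) * q = q * a * q - z • q := by
    rw [sub_mul, mul_assoc _ q q, hq, smul_mul_assoc, hq]
  have hqD : q * (q * a * q - z • q) = q * a * q - z • q := by
    rw [mul_sub, ← mul_assoc, ← mul_assoc, hq, mul_smul_comm, hq]
  have hCq : (p * a * q) * q = p * a * q := by rw [mul_assoc, hq]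
  have hpC : p * (p * a * q) = p * a * q := by rw [← mul_assoc, ← mul_assoc, hp]
  generalize p * a * p - z • p = A at *
  generalize q * a * q - z • q = D at *
  generalize p * a * q = C at *
  have hpy : p * y = y := by rw [← hy, ← mul_assoc, ← mul_assoc, hp]
  have hyp : y * p = y := by rw [← hy, mul_assoc, hp]
  have hqw : q * w = w := by rw [← hw, ← mul_assoc, ← mul_assoc, hq]
  have hwq : w * q = w := by rw [← hw, mul_assoc, hq]
  have z1 : ∀ s t : B, s * p = s → q * t = t → s * t = 0 := fun s t hs ht => by
    rw [← hs, ← ht, mul_assoc, ← mul_assoc p, hpq, zero_mul, mul_zero]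
  have z2 : ∀ s t : B, s * q = s → p * t = t → s * t = 0 := fun s t hs ht => by
    rw [← hs, ← ht, mul_assoc, ← mul_assoc q, hqp, zero_mul, mul_zero]
  have qy : q * y = 0 := z2 _ _ hq hpy
  have wp : w * p = 0 := by rw [← hwq, mul_assoc, hqp, mul_zero]
  have yq : y * q = 0 := z1 _ _ hyp hq
  have pw : p * w = 0 := z1 _ _ hp hqw
  refine ⟨y + w - y * C * w, ?_, ?_, ?_⟩
  · have l : (p + q) * (y + w - y * C * w) = y + w - y * C * w := by
      have : (p + q) * (y + w - y * C * w) = p * y + q * y + p * w + q * w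
        - (p * y) * C * w - (q * y) * C * w := by noncomm_ring
      rw [this, hpy, qy, pw, hqw]; simp
    have r : (y + w - y * C * w) * (p + q) = y + w - y * C * w := by
      have : (y + w - y * C * w) * (p + q) = y * p + y * q + w * p + w * q
        - y * C * (w * p) - y * C * (w * q) := by noncomm_ring
      rw [this, hyp, yq, wp, hwq]; simp
    rw [l, r]
  · have : (A + D + C) * (y + w - y * C * w) = A * y + D * y + C * y + A * w + D * w + C * w
        - (A * y) * C * w - (D * y) * C * w - (C * y) * C * w := by noncomm_ring
    rw [this, hy1, hw1, z2 D y hDq hpy, z2 C y hCq hpy, z1 A w hAp hqw, hpC]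
    simp
  · have : (y + w - y * C * w) * (A + D + C) = y * A + y * D + y * C + w * A + w * D + w * C
        - y * C * (w * A) - y * C * (w * D) - y * C * (w * C) := by noncomm_ring
    rw [this, hy2, hw2, z1 y D hyp hqD, z2 w A hwq hpA, z2 w C hwq hpC, mul_assoc y C q, hCq]
    simp only [mul_zero, add_zero, sub_zero]
    abel

/-- Here `p i` plays the role of `p_{i+1}` in the paper, so that
`∑ i ∈ Finset.range n, p i` is `P_n`; the paper's index `n ≥ 1` corresponds to `n - 1` below. -/
theorem cornerSpectrum_subset_iUnion_zero
    {B : Type*} [CStarAlgebra B] (a : B) (p : ℕ → B)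
    (hsa : ∀ i, IsSelfAdjoint (p i)) (hidem : ∀ i, p i * p i = p i)
    (hne : ∀ i, p i ≠ 0)
    (horth : ∀ i i', i ≠ i' → p i * p i' = 0)
    (h1 : ∀ n : ℕ,
      (1 - ∑ i ∈ Finset.range n, p i) * a * (∑ i ∈ Finset.range n, p i) = 0)
    (h2 : Filter.Tendsto
      (fun n : ℕ => ‖(1 - ∑ i ∈ Finset.range n, p i) * a * (1 - ∑ i ∈ Finset.range n, p i)‖)
      Filter.atTop (nhds 0)) :
    ∀ n : ℕ,
      cornerSpectrum (1 - ∑ i ∈ Finset.range n, p i)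
          ((1 - ∑ i ∈ Finset.range n, p i) * a * (1 - ∑ i ∈ Finset.range n, p i)) ⊆
        (⋃ j ∈ Set.Ici n, cornerSpectrum (p j) (p j * a * p j)) ∪ {0} := by
  intro n z hz
  by_contra hcon
  simp only [Set.mem_union, Set.mem_iUnion, Set.mem_singleton_iff, not_or, not_exists,
    Set.mem_Ici] at hcon
  obtain ⟨hj, hz0⟩ := hcon
  have hj' : ∀ j, n ≤ j → cornerInvertible (p j) (p j * a * p j - z • p j) := fun j hnj => by
    have := hj j hnj
    simpa [cornerSpectrum] using this
  apply hz
  haveI : Nontrivial B := ⟨⟨p 0, 0, hne 0⟩⟩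
  have hPp : ∀ m j, (∑ i ∈ Finset.range m, p i) * p j = if j < m then p j else 0 := by
    intro m j
    rw [Finset.sum_mul, Finset.sum_congr rfl (g := fun i => if i = j then p j else 0)]
    · simp
    · intro i _
      split_ifs with hij
      · rw [hij, hidem]
      · exact horth _ _ hij
  have hpP : ∀ m j, p j * (∑ i ∈ Finset.range m, p i) = if j < m then p j else 0 := by
    intro m j
    rw [Finset.mul_sum, Finset.sum_congr rfl (g := fun i => if i = j then p j else 0)]
    · simp
    · intro i _
      split_ifs with hij
      · rw [hij, hidem]
      · exact horth _ _ (Ne.symm hij)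
  have hPP : ∀ m, (∑ i ∈ Finset.range m, p i) * (∑ i ∈ Finset.range m, p i)
      = ∑ i ∈ Finset.range m, p i := by
    intro m
    conv_lhs => rw [Finset.mul_sum]
    refine Finset.sum_congr rfl fun j hj => ?_
    rw [hPp, if_pos (Finset.mem_range.1 hj)]
  have hQ : ∀ m, (1 - ∑ i ∈ Finset.range m, p i) * (1 - ∑ i ∈ Finset.range m, p i)
      = 1 - ∑ i ∈ Finset.range m, p i := by
    intro m
    rw [mul_sub, sub_mul, sub_mul, hPP]; simp
  have hev := h2.eventually (gt_mem_nhds (norm_pos_iff.2 hz0))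
  obtain ⟨m, hm, hnm⟩ := (hev.and (Filter.eventually_ge_atTop n)).exists
  have hbase := corner_base (1 - ∑ i ∈ Finset.range m, p i) _ z (hQ m)
    (by rw [← mul_assoc, ← mul_assoc, hQ]) (by rw [mul_assoc, hQ]) hm
  clear hm hev
  revert hbase
  induction m, hnm using Nat.le_induction with
  | base => exact id
  | succ m hnm ih =>
    intro hb
    apply ih
    have e : (1 - ∑ i ∈ Finset.range m, p i) = p m + (1 - ∑ i ∈ Finset.range (m + 1), p i) := by
      rw [Finset.sum_range_succ]; abel
    rw [e]
    refine corner_step (p m) _ a z (hidem m) (hQ _) ?_ ?_ ?_ (hj' m hnm) hb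
    · rw [mul_sub, hpP]; simp
    · rw [sub_mul, hPp]; simp
    · have := congrArg (· * p m) (h1 (m + 1))
      simpa [mul_assoc, hPp] using this
end

section
/- Let B be a unital C*-algebra, a ∈ B, and (p_i)_{i∈ℕ} a sequence of nonzero mutually orthogonal projections in B satisfying conditions (1)–(4). Then for every n ∈ ℕ: (a) σ_{p_n B p_n}(p_n a p_n) ∩ σ_{(1−P_n)B(1−P_n)}((1 − P_n) a (1 − P_n)) = ∅; and (b) p_n ∈ C*({(1 − P_{n−1}) a (1 − P_{n−1})}). -/
open Filter Topology

/-- Difference of commuting elements with disjoint spectra is a unit. -/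
theorem isUnit_sub_of_disjoint {E : Type*} [NormedRing E] [NormedAlgebra ℂ E] [CompleteSpace E]
    (L R : E) (hLR : L * R = R * L) (h : Disjoint (spectrum ℂ L) (spectrum ℂ R)) :
    IsUnit (L - R) := by
  have hcomm : ∀ x ∈ ({L, R} : Set E), ∀ y ∈ ({L, R} : Set E), x * y = y * x := by
    intro x hx y hy
    rcases hx with rfl | rfl <;> rcases hy with rfl | rfl <;> simp [hLR]
  let C : Subalgebra ℂ E := Subalgebra.centralizer ℂ (Set.centralizer ({L, R} : Set E))
  have hL : L ∈ C := Set.subset_centralizer_centralizer (by simp)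
  have hR : R ∈ C := Set.subset_centralizer_centralizer (by simp)
  have hcl : IsClosed (C : Set E) := Set.isClosed_centralizer _
  let _ : NormedCommRing C :=
    { (inferInstance : NormedRing C) with
      mul_comm := fun a b => Subtype.ext
        (Set.centralizer_centralizer_comm_of_comm hcomm _ a.2 _ b.2) }
  have : CompleteSpace C := hcl.completeSpace_coe
  let _ : NormedAlgebra ℂ C := Subalgebra.toNormedAlgebra C
  have hinv : ∀ s : C, IsUnit (s : E) → IsUnit s := by
    intro s hs
    obtain ⟨u, hu⟩ := hs
    have hm : ((u⁻¹ : Eˣ) : E) ∈ C := by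
      intro g hg
      have h1 : Commute g (u : E) := by
        have := s.2 g hg
        rw [hu]; exact this
      exact h1.units_inv_right
    refine isUnit_iff_exists.2 ⟨⟨_, hm⟩, Subtype.ext ?_, Subtype.ext ?_⟩
    · change (s : E) * _ = 1
      rw [← hu]; simp
    · change _ * (s : E) = 1
      rw [← hu]; simp
  have hspec : ∀ s : C, spectrum ℂ s ⊆ spectrum ℂ (s : E) := by
    intro s z hz hz'
    exact hz (hinv _ hz')
  have key : IsUnit ((⟨L, hL⟩ : C) - ⟨R, hR⟩) := by
    by_contra hn
    obtain ⟨f, hf⟩ := WeakDual.CharacterSpace.exists_apply_eq_zero hn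
    rw [map_sub, sub_eq_zero] at hf
    have e1 := hspec _ (AlgHom.apply_mem_spectrum f (⟨L, hL⟩ : C))
    have e2 := hspec _ (AlgHom.apply_mem_spectrum f (⟨R, hR⟩ : C))
    rw [hf] at e1
    exact Set.disjoint_left.1 h e1 e2
  exact key.map C.subtype

theorem sylvester {B : Type*} [CStarAlgebra B] (x y : B)
    (h : Disjoint (spectrum ℂ x) (spectrum ℂ y)) (b : B) : ∃ c, x * c - c * y = b := by
  let L : B →L[ℂ] B := ContinuousLinearMap.mul ℂ B x
  let R : B →L[ℂ] B := (ContinuousLinearMap.mul ℂ B).flip y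
  have hLR : L * R = R * L := by
    ext t; simp [L, R, mul_assoc]
  have hL : spectrum ℂ L ⊆ spectrum ℂ x := by
    intro z hz hu
    apply hz
    obtain ⟨d, h1, h2⟩ := isUnit_iff_exists.1 hu
    refine isUnit_iff_exists.2 ⟨ContinuousLinearMap.mul ℂ B d, ?_, ?_⟩
    · ext t
      have := congrArg (· * t) h1
      simpa [L, Algebra.algebraMap_eq_smul_one, sub_mul, mul_assoc] using this
    · ext t
      have := congrArg (· * t) h2
      simpa [L, Algebra.algebraMap_eq_smul_one, sub_mul, mul_sub, mul_assoc] using this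
  have hR : spectrum ℂ R ⊆ spectrum ℂ y := by
    intro z hz hu
    apply hz
    obtain ⟨d, h1, h2⟩ := isUnit_iff_exists.1 hu
    refine isUnit_iff_exists.2 ⟨(ContinuousLinearMap.mul ℂ B).flip d, ?_, ?_⟩
    · ext t
      have := congrArg (t * ·) h2
      simpa [R, Algebra.algebraMap_eq_smul_one, sub_mul, mul_sub, mul_assoc] using this
    · ext t
      have := congrArg (t * ·) h1
      simpa [R, Algebra.algebraMap_eq_smul_one, sub_mul, mul_sub, mul_assoc] using this
  obtain ⟨d, h1, h2⟩ := isUnit_iff_exists.1 (isUnit_sub_of_disjoint L R hLR (h.mono hL hR))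
  refine ⟨d b, ?_⟩
  have := congrArg (fun f : B →L[ℂ] B => f b) h1
  simpa [L, R] using this

/-- The multiplier algebra of `A` inside `B`. -/
def multAlg {B : Type*} [CStarAlgebra B] (A : NonUnitalStarSubalgebra ℂ B) :
    StarSubalgebra ℂ B where
  carrier := {s | ∀ t ∈ A, s * t ∈ A ∧ t * s ∈ A}
  mul_mem' := by
    intro s s' hs hs' t ht
    refine ⟨?_, ?_⟩
    · rw [mul_assoc]; exact (hs _ (hs' t ht).1).1
    · rw [← mul_assoc]; exact (hs' _ (hs t ht).2).2
  add_mem' := by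
    intro s s' hs hs' t ht
    rw [add_mul, mul_add]
    exact ⟨add_mem (hs t ht).1 (hs' t ht).1, add_mem (hs t ht).2 (hs' t ht).2⟩
  algebraMap_mem' := by
    intro r t ht
    rw [Algebra.algebraMap_eq_smul_one, smul_mul_assoc, mul_smul_comm, one_mul, mul_one]
    exact ⟨SMulMemClass.smul_mem r ht, SMulMemClass.smul_mem r ht⟩
  star_mem' := by
    intro s hs t ht
    have := hs (star t) (star_mem ht)
    refine ⟨?_, ?_⟩
    · have h := star_mem this.2
      simpa using h
    · have h := star_mem this.1
      simpa using h

theorem mem_multAlg {B : Type*} [CStarAlgebra B] (A : NonUnitalStarSubalgebra ℂ B) (s : B) :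
    s ∈ multAlg A ↔ ∀ t ∈ A, s * t ∈ A ∧ t * s ∈ A := Iff.rfl

theorem isClosed_multAlg {B : Type*} [CStarAlgebra B] (A : NonUnitalStarSubalgebra ℂ B)
    (hA : IsClosed (A : Set B)) : IsClosed (multAlg A : Set B) := by
  have : (multAlg A : Set B) = ⋂ t ∈ A, {s | s * t ∈ (A : Set B)} ∩ {s | t * s ∈ (A : Set B)} := by
    ext s; simp [mem_multAlg]
  rw [this]
  refine isClosed_biInter fun t _ => ?_
  exact (hA.preimage (by fun_prop)).inter (hA.preimage (by fun_prop))

theorem mul_inv_mem {B : Type*} [CStarAlgebra B] (A : NonUnitalStarSubalgebra ℂ B)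
    (hA : IsClosed (A : Set B)) (s r t : B) (hs : s ∈ multAlg A) (h1 : s * r = 1)
    (h2 : r * s = 1) (ht : t ∈ A) : t * r ∈ A := by
  have hcl := isClosed_multAlg A hA
  have : IsClosed (multAlg A : Set B) := hcl
  have hu : IsUnit ((⟨s, hs⟩ : multAlg A) : B) := isUnit_iff_exists.2 ⟨r, h1, h2⟩
  have hu' := (StarSubalgebra.coe_isUnit (multAlg A)).1 hu
  obtain ⟨d, h3, h4⟩ := isUnit_iff_exists.1 hu'
  have h3' : s * (d : B) = 1 := congrArg Subtype.val h3
  have : r = d := left_inv_eq_right_inv h2 h3'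
  rw [this]
  exact (d.2 t ht).2

theorem idem_mem {B : Type*} [CStarAlgebra B] (A : NonUnitalStarSubalgebra ℂ B)
    (hA : IsClosed (A : Set B)) (T p x y v w : B) (hT : T ∈ A) (hvw : v * w = 1) (hwv : w * v = 1)
    (hp : p * p = p) (hpx : p * x = x * p) (hpy : p * y = 0) (hyp : y * p = 0)
    (hTD : T = v * (p * x + y) * w) (hd : Disjoint (spectrum ℂ x) (spectrum ℂ y))
    (h0 : (0 : ℂ) ∉ spectrum ℂ x) : v * p * w ∈ A := by
  classical
  have hTM : T ∈ multAlg A := fun t ht => ⟨mul_mem hT ht, mul_mem ht hT⟩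
  let S : Submodule ℂ B := A.toNonUnitalSubalgebra.toSubmodule
  have hS : IsClosed (S : Set B) := hA
  -- resolvent facts
  have hres : ∀ (u : B) (z : ℂ), z ∉ spectrum ℂ u →
      (z • 1 - u) * resolvent u z = 1 ∧ resolvent u z * (z • 1 - u) = 1 := by
    intro u z hz
    have hz' : IsUnit (algebraMap ℂ B z - u) := spectrum.notMem_iff.1 hz
    rw [Algebra.algebraMap_eq_smul_one] at hz'
    unfold resolvent
    rw [Algebra.algebraMap_eq_smul_one]
    exact ⟨Ring.mul_inverse_cancel _ hz', Ring.inverse_mul_cancel _ hz'⟩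
  let Ax : B →L[ℂ] B := ContinuousLinearMap.mul ℂ B (v * (p * x))
  let Ay : B →L[ℂ] B := ContinuousLinearMap.mul ℂ B (v * y)
  let W : B →L[ℂ] B := (ContinuousLinearMap.mul ℂ B).flip w
  let gx : B →L[ℂ] B ⧸ S := S.mkQL ∘L W ∘L Ax
  let gy : B →L[ℂ] B ⧸ S := S.mkQL ∘L W ∘L Ay
  let F1 : ℂ → B ⧸ S := fun z => gx (resolvent x z)
  let F2 : ℂ → B ⧸ S := fun z => - gy (resolvent y z)
  have hd1 : ∀ z, z ∉ spectrum ℂ x → DifferentiableAt ℂ F1 z := by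
    intro z hz
    exact gx.differentiableAt.comp z
      (spectrum.hasDerivAt_resolvent_const_left (spectrum.notMem_iff.1 hz)).differentiableAt
  have hd2 : ∀ z, z ∉ spectrum ℂ y → DifferentiableAt ℂ F2 z := by
    intro z hz
    exact (gy.differentiableAt.comp z
      (spectrum.hasDerivAt_resolvent_const_left (spectrum.notMem_iff.1 hz)).differentiableAt).neg
  have heq : ∀ z, z ∉ spectrum ℂ x → z ∉ spectrum ℂ y → F1 z = F2 z := by
    intro z hzx hzy
    obtain ⟨a1, a2⟩ := hres x z hzx
    obtain ⟨b1, b2⟩ := hres y z hzy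
    set R1 := resolvent x z
    set R2 := resolvent y z
    have hpR1 : p * R1 = R1 * p := by
      have c1 : p * (z • 1 - x) = (z • 1 - x) * p := by
        rw [mul_sub, sub_mul, hpx]; simp
      calc p * R1 = (R1 * (z • 1 - x)) * p * R1 := by rw [a2, one_mul]
        _ = R1 * ((z • 1 - x) * p) * R1 := by simp only [mul_assoc]
        _ = R1 * p * ((z • 1 - x) * R1) := by rw [← c1]; simp only [mul_assoc]
        _ = R1 * p := by rw [a1, mul_one]
    have hpR2 : p * R2 = R2 * p := by
      have c1 : p * (z • 1 - y) = (z • 1 - y) * p := by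
        rw [mul_sub, sub_mul, hpy, hyp]; simp
      calc p * R2 = (R2 * (z • 1 - y)) * p * R2 := by rw [b2, one_mul]
        _ = R2 * ((z • 1 - y) * p) * R2 := by simp only [mul_assoc]
        _ = R2 * p * ((z • 1 - y) * R2) := by rw [← c1]; simp only [mul_assoc]
        _ = R2 * p := by rw [b1, mul_one]
    set D := p * x + y with hD
    set K := p * R1 + (1 - p) * R2 with hK
    have e1 : (z • 1 - D) * p = p * (z • 1 - x) := by
      rw [hD, sub_mul, add_mul, hyp, mul_assoc, ← hpx, ← mul_assoc, hp, mul_sub]; simp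
    have e1' : p * (z • 1 - D) = p * (z • 1 - x) := by
      rw [hD, mul_sub, mul_add, hpy, ← mul_assoc, hp, mul_sub]; simp
    have e2 : (z • 1 - D) * (1 - p) = (1 - p) * (z • 1 - y) := by
      rw [mul_sub, e1, hD, sub_mul 1 p, mul_sub p (z • 1) y, hpy, mul_sub]; simp; abel
    have e2' : (1 - p) * (z • 1 - D) = (1 - p) * (z • 1 - y) := by
      rw [sub_mul, e1', hD, sub_mul 1 p, mul_sub p (z • 1) y, hpy, mul_sub p]; simp; abel
    have k1 : (z • 1 - D) * K = 1 := by
      rw [hK, mul_add, ← mul_assoc, ← mul_assoc, e1, e2, mul_assoc, mul_assoc, a1, b1]; simp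
    have k2 : K * (z • 1 - D) = 1 := by
      have : K = R1 * p + R2 * (1 - p) := by
        rw [hK, hpR1, sub_mul, mul_sub, hpR2]; simp
      have c1 : p * (z • 1 - x) = (z • 1 - x) * p := by
        rw [mul_sub, sub_mul, hpx]; simp
      have c2 : (1 - p) * (z • 1 - y) = (z • 1 - y) * (1 - p) := by
        simp only [mul_sub, sub_mul, hpy, hyp]; simp; abel
      rw [this, add_mul, mul_assoc, mul_assoc, e1', e2', c1, c2, ← mul_assoc, ← mul_assoc, a2, b2]
      simp
    have hDK : D * K = p * x * R1 + y * R2 := by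
      have f1 : D * p = p * x := by
        rw [hD, add_mul, hyp, mul_assoc, ← hpx, ← mul_assoc, hp, add_zero]
      have f2 : D * (1 - p) = y := by
        rw [mul_sub, f1, hD]; simp
      rw [hK, mul_add, ← mul_assoc, ← mul_assoc, f1, f2]
    have hzT : z • 1 - T = v * (z • 1 - D) * w := by
      rw [hTD, mul_sub, sub_mul]; simp [hvw]
    have hmem : T * (v * K * w) ∈ A := by
      apply mul_inv_mem A hA (z • 1 - T) (v * K * w) T ?_ ?_ ?_ hT
      · exact sub_mem ((multAlg A).smul_mem (one_mem _) z) hTM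
      · rw [hzT]
        calc v * (z • 1 - D) * w * (v * K * w) = v * (z • 1 - D) * (w * v) * K * w := by
              simp only [mul_assoc]
          _ = v * ((z • 1 - D) * K) * w := by rw [hwv]; simp only [mul_assoc, one_mul]
          _ = 1 := by rw [k1, mul_one, hvw]
      · rw [hzT]
        calc (v * K * w) * (v * (z • 1 - D) * w) = v * K * (w * v) * (z • 1 - D) * w := by
              simp only [mul_assoc]
          _ = v * (K * (z • 1 - D)) * w := by rw [hwv]; simp only [mul_assoc, one_mul]
          _ = 1 := by rw [k2, mul_one, hvw]
    have hval : T * (v * K * w) = v * (p * x) * R1 * w + v * y * R2 * w := by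
      calc T * (v * K * w) = v * D * (w * v) * K * w := by rw [hTD]; simp only [mul_assoc]
        _ = v * (D * K) * w := by rw [hwv]; simp only [mul_assoc, one_mul]
        _ = _ := by rw [hDK]; simp only [mul_add, add_mul, mul_assoc]
    have hz : S.mkQ (v * (p * x) * R1 * w + v * y * R2 * w) = 0 := by
      rw [Submodule.mkQ_apply, Submodule.Quotient.mk_eq_zero, ← hval]; exact hmem
    rw [map_add] at hz
    exact eq_neg_of_add_eq_zero_left hz
  let G : ℂ → B ⧸ S := fun z => if z ∈ spectrum ℂ x then F2 z else F1 z
  have hG1 : ∀ z, z ∉ spectrum ℂ x → G z = F1 z := fun z hz => if_neg hz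
  have hG2 : ∀ z, z ∉ spectrum ℂ y → G z = F2 z := by
    intro z hz
    by_cases hx : z ∈ spectrum ℂ x
    · exact if_pos hx
    · rw [hG1 z hx, heq z hx hz]
  have hGd : Differentiable ℂ G := by
    intro z
    by_cases hx : z ∈ spectrum ℂ x
    · have hy : z ∉ spectrum ℂ y := Set.disjoint_left.1 hd hx
      refine (hd2 z hy).congr_of_eventuallyEq ?_
      filter_upwards [(spectrum.isClosed (𝕜 := ℂ) y).isOpen_compl.mem_nhds hy] with t ht
      exact hG2 t ht
    · refine (hd1 z hx).congr_of_eventuallyEq ?_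
      filter_upwards [(spectrum.isClosed (𝕜 := ℂ) x).isOpen_compl.mem_nhds hx] with t ht
      exact hG1 t ht
  have hlim : Tendsto G (cocompact ℂ) (𝓝 0) := by
    have l1 : Tendsto F1 (cocompact ℂ) (𝓝 0) := by
      rw [← Metric.cobounded_eq_cocompact]
      have := (gx.continuous.tendsto 0).comp (spectrum.resolvent_tendsto_cobounded (𝕜 := ℂ) x)
      rwa [map_zero] at this
    refine l1.congr' ?_
    filter_upwards [(spectrum.isCompact (𝕜 := ℂ) x).compl_mem_cocompact] with t ht
    exact (hG1 t ht).symm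
  have hG0 := hGd.apply_eq_of_tendsto_cocompact 0 hlim
  rw [hG1 0 h0] at hG0
  obtain ⟨a1, a2⟩ := hres x 0 h0
  have hm : v * (p * x) * resolvent x (0 : ℂ) * w ∈ A := by
    have : S.mkQ (v * (p * x) * resolvent x (0 : ℂ) * w) = 0 := hG0
    rw [Submodule.mkQ_apply, Submodule.Quotient.mk_eq_zero] at this
    exact this
  have hx1 : x * resolvent x (0 : ℂ) = -1 := by
    rw [zero_smul, zero_sub, neg_mul] at a1
    rw [← a1, neg_neg]
  have : v * (p * x) * resolvent x (0 : ℂ) * w = -(v * p * w) := by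
    calc _ = v * p * (x * resolvent x (0 : ℂ)) * w := by simp only [mul_assoc]
      _ = _ := by rw [hx1]; simp
  rw [this] at hm
  simpa using neg_mem hm

theorem proj_mem_s7 {B : Type*} [CStarAlgebra B] (A : NonUnitalStarSubalgebra ℂ B)
    (hA : IsClosed (A : Set B)) (T p : B) (l : ℂ) (hT : T ∈ A)
    (hsa : IsSelfAdjoint p) (hp : p * p = p) (hTp : (1 - p) * T * p = 0)
    (hd : Disjoint (spectrum ℂ (p * T * p + l • (1 - p))) (spectrum ℂ ((1 - p) * T * (1 - p))))
    (h0 : (0 : ℂ) ∉ spectrum ℂ (p * T * p + l • (1 - p))) : p ∈ A := by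
  obtain ⟨c0, hc0⟩ := sylvester _ _ hd (p * T * (1 - p))
  set q := 1 - p with hq
  have hpq : p * q = 0 := by rw [hq, mul_sub, hp]; simp
  have hqp : q * p = 0 := by rw [hq, sub_mul, hp]; simp
  have hqq : q * q = q := by nth_rewrite 1 [hq]; rw [sub_mul, hpq]; simp
  set x := p * T * p + l • q with hx
  set y := q * T * q with hy
  have hpx : p * x = p * T * p := by
    rw [hx, mul_add, mul_smul_comm, hpq, ← mul_assoc, ← mul_assoc, hp]; simp
  have hxp : x * p = p * T * p := by
    rw [hx, add_mul, smul_mul_assoc, hqp, mul_assoc, hp]; simp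
  have hpy : p * y = 0 := by rw [hy, ← mul_assoc, ← mul_assoc, hpq]; simp
  have hyp : y * p = 0 := by rw [hy, mul_assoc, hqp]; simp
  have hyq : y * q = y := by rw [hy, mul_assoc, hqq]
  have hqy : q * y = y := by rw [hy, ← mul_assoc, ← mul_assoc, hqq]
  set c := p * c0 * q with hc
  have hpc : p * c = c := by rw [hc, ← mul_assoc, ← mul_assoc, hp]
  have hcp : c * p = 0 := by rw [hc, mul_assoc, hqp, mul_zero]
  have hcc : c * c = 0 := by
    nth_rewrite 2 [← hpc]; rw [← mul_assoc, hcp, zero_mul]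
  have hyc : y * c = 0 := by rw [← hpc, ← mul_assoc, hyp, zero_mul]
  have hsy : p * x * c - c * y = p * T * q := by
    have e1 : p * x * c = p * (x * c0) * q := by
      rw [hpx, ← hxp, hc]
      calc x * p * (p * c0 * q) = x * (p * p) * c0 * q := by simp only [mul_assoc]
        _ = _ := by rw [hp, hxp, ← hpx]; simp only [mul_assoc]
    have e2 : c * y = p * (c0 * y) * q := by
      calc c * y = p * c0 * (q * y) := by rw [hc]; simp only [mul_assoc]
        _ = p * c0 * (y * q) := by rw [hqy, hyq]
        _ = _ := by simp only [mul_assoc]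
    rw [e1, e2, ← sub_mul, ← mul_sub, hc0]
    calc p * (p * T * q) * q = (p * p) * T * (q * q) := by simp only [mul_assoc]
      _ = _ := by rw [hp, hqq]
  have hTdec : T = p * x + p * T * q + y := by
    have h1 : T * p = p * T * p := by
      rw [hq, sub_mul, sub_mul, one_mul, sub_eq_zero] at hTp; exact hTp
    have h2 : T * q = p * T * q + y := by
      rw [hy, ← add_mul, ← add_mul, hq]; simp
    calc T = T * p + T * q := by rw [← mul_add, hq]; simp
      _ = _ := by rw [h1, h2, hpx, add_assoc]
  have hcpx : c * (p * x) = 0 := by rw [← mul_assoc, hcp, zero_mul]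
  have he := idem_mem A hA T p x y (1 - c) (1 + c) hT
    (by simp [mul_add, sub_mul, hcc]) (by simp [mul_sub, add_mul, hcc])
    hp (hpx.trans hxp.symm) hpy hyp
    (by
      rw [sub_mul, mul_add c, hcpx, zero_add, one_mul, mul_add, mul_one, sub_mul, add_mul, hyc,
        mul_assoc c y c, hyc]
      calc T = p * x + p * T * q + y := hTdec
        _ = _ := by rw [← hsy]; simp; abel) hd h0
  have hev : (1 - c) * p * (1 + c) = p + c := by
    rw [sub_mul, hcp, mul_add]; simp [hpc]
  rw [hev] at he
  set e := p + c with hedef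
  have hpe : p * e = e := by rw [hedef, mul_add, hp, hpc]
  have hep : e * p = p := by rw [hedef, add_mul, hp, hcp, add_zero]
  have hee : e * e = e := by nth_rewrite 2 [← hpe]; rw [← mul_assoc, hep, hpe]
  have hps : p * star e = p := by
    have := congrArg star hep
    rwa [star_mul, hsa.star_eq] at this
  set d := e - star e with hdd
  have hdA : d ∈ A := sub_mem he (star_mem he)
  have hsd : star d * d ∈ A := mul_mem (star_mem hdA) hdA
  have hu : IsUnit (1 + star d * d) := by
    have h1 : (-1 : ℝ) ∉ spectrum ℝ (star d * d) := by
      intro h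
      have := spectrum_star_mul_self_nonneg _ h
      norm_num at this
    have h2 := (spectrum.notMem_iff.1 h1).neg
    simpa [add_comm] using h2
  obtain ⟨r, hr1, hr2⟩ := isUnit_iff_exists.1 hu
  have hM : 1 + star d * d ∈ multAlg A :=
    add_mem (one_mem _) (fun t ht => ⟨mul_mem hsd ht, mul_mem ht hsd⟩)
  have hfin := mul_inv_mem A hA _ r (e * star e) hM hr1 hr2 (mul_mem he (star_mem he))
  have hpz : p * (1 + star d * d) = e * star e := by
    have h1 : p * star d = p - e := by
      rw [hdd, star_sub, star_star, mul_sub, hps, hpe]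
    rw [mul_add, ← mul_assoc, h1, hdd, mul_sub, sub_mul, sub_mul, hpe, hee, hps]
    simp
  rw [← hpz, mul_assoc, hr1, mul_one] at hfin
  exact hfin

theorem notMem_spectrum_of_corner {B : Type*} [CStarAlgebra B] (p u : B) (z m : ℂ)
    (hp : p * p = p) (hu : p * u * p = u) (hm : m ≠ z) (h : cornerInvertible p (u - z • p)) :
    z ∉ spectrum ℂ (u + m • (1 - p)) := by
  obtain ⟨y, hy, h1, h2⟩ := h
  have hm' : m - z ≠ 0 := sub_ne_zero.2 hm
  set q := 1 - p with hq
  have hpq : p * q = 0 := by rw [hq, mul_sub, hp]; simp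
  have hqp : q * p = 0 := by rw [hq, sub_mul, hp]; simp
  have hqq : q * q = q := by nth_rewrite 1 [hq]; rw [sub_mul, hpq]; simp
  have hyq : y * q = 0 := by rw [← hy, mul_assoc, hpq, mul_zero]
  have hqy : q * y = 0 := by rw [← hy, ← mul_assoc, ← mul_assoc, hqp]; simp
  have huq : (u - z • p) * q = 0 := by
    rw [sub_mul, smul_mul_assoc, hpq, ← hu, mul_assoc, hpq]; simp
  have hqu : q * (u - z • p) = 0 := by
    rw [mul_sub, mul_smul_comm, hqp, ← hu, ← mul_assoc, ← mul_assoc, hqp]; simp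
  have key : algebraMap ℂ B z - (u + m • q) = -((u - z • p) + (m - z) • q) := by
    rw [Algebra.algebraMap_eq_smul_one, hq]
    module
  rw [spectrum.notMem_iff, key]
  apply IsUnit.neg
  refine isUnit_iff_exists.2 ⟨y + (m - z)⁻¹ • q, ?_, ?_⟩
  · rw [mul_add, add_mul, add_mul, h1, smul_mul_assoc, hqy, mul_smul_comm, huq, mul_smul_comm,
      smul_mul_assoc, hqq, smul_smul, inv_mul_cancel₀ hm', hq]
    simp
  · rw [mul_add, add_mul, add_mul, h2, smul_mul_assoc, hqu, mul_smul_comm, hyq, mul_smul_comm,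
      smul_mul_assoc, hqq, smul_smul, mul_inv_cancel₀ hm', hq]
    simp

theorem corner_block {B : Type*} [CStarAlgebra B] (p q u : B)
    (hp : p * p = p) (hq : q * q = q) (hpq : p * q = 0) (hqp : q * p = 0) (hqup : q * u * p = 0)
    (h1 : cornerInvertible p (p * u * p)) (h2 : cornerInvertible q (q * u * q)) :
    cornerInvertible (p + q) ((p + q) * u * (p + q)) := by
  obtain ⟨s, hs, s1, s2⟩ := h1
  obtain ⟨t, ht, t1, t2⟩ := h2
  have hps : p * s = s := by rw [← hs, ← mul_assoc, ← mul_assoc, hp]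
  have hsp : s * p = s := by rw [← hs, mul_assoc, hp]
  have hqt : q * t = t := by rw [← ht, ← mul_assoc, ← mul_assoc, hq]
  have htq : t * q = t := by rw [← ht, mul_assoc, hq]
  have hqs : q * s = 0 := by rw [← hps, ← mul_assoc, hqp, zero_mul]
  have hsq : s * q = 0 := by rw [← hsp, mul_assoc, hpq, mul_zero]
  have hpt : p * t = 0 := by rw [← hqt, ← mul_assoc, hpq, zero_mul]
  have htp : t * p = 0 := by rw [← htq, mul_assoc, hqp, mul_zero]
  have hX : (p + q) * u * (p + q) = p * u * p + p * u * q + q * u * q := by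
    rw [mul_add, add_mul, add_mul, add_mul, hqup]; abel
  refine ⟨s + t - s * u * t, ?_, ?_, ?_⟩
  · have e1 : (p + q) * (s + t - s * u * t) = s + t - s * u * t := by
      rw [mul_sub, add_mul, mul_add, mul_add, add_mul, ← mul_assoc, ← mul_assoc, ← mul_assoc,
        ← mul_assoc, hps, hqs, hpt, hqt]
      simp
    rw [e1, sub_mul, add_mul, mul_add, mul_add, mul_add, mul_assoc _ t, mul_assoc _ t, htp, htq,
      hsp, hsq]
    simp
  · have a1 : p * u * p * t = 0 := by rw [mul_assoc, hpt, mul_zero]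
    have a2 : p * u * p * (s * u * t) = p * u * t := by
      rw [← mul_assoc, ← mul_assoc, s1]
    have a3 : p * u * q * s = 0 := by rw [mul_assoc, hqs, mul_zero]
    have a4 : p * u * q * t = p * u * t := by rw [mul_assoc, hqt]
    have a5 : p * u * q * (s * u * t) = 0 := by rw [← mul_assoc, ← mul_assoc, a3]; simp
    have a6 : q * u * q * s = 0 := by rw [mul_assoc, hqs, mul_zero]
    have a7 : q * u * q * (s * u * t) = 0 := by rw [← mul_assoc, ← mul_assoc, a6]; simp
    rw [hX]
    simp only [mul_sub, mul_add, add_mul, a1, a2, a3, a4, a5, a6, a7, s1, t1]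
    abel
  · have a1 : t * (p * u * p) = 0 := by rw [← mul_assoc, ← mul_assoc, htp]; simp
    have a2 : s * u * t * (q * u * q) = s * u * q := by
      rw [mul_assoc, t2]
    have a3 : t * (p * u * q) = 0 := by rw [← mul_assoc, ← mul_assoc, htp]; simp
    have a4 : s * (p * u * q) = s * u * q := by rw [← mul_assoc, ← mul_assoc, hsp]
    have a5 : s * u * t * (p * u * q) = 0 := by rw [mul_assoc, a3, mul_zero]
    have a6 : s * (q * u * q) = 0 := by rw [← mul_assoc, ← mul_assoc, hsq]; simp
    have a7 : s * u * t * (p * u * p) = 0 := by rw [mul_assoc, a1, mul_zero]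
    rw [hX]
    simp only [sub_mul, mul_add, add_mul, a1, a2, a3, a4, a5, a6, a7, s2, t2]
    abel

theorem corner_of_norm {B : Type*} [CStarAlgebra B] [Nontrivial B] (q a : B) (z : ℂ)
    (hq : q * q = q) (h : ‖q * a * q‖ < ‖z‖) :
    cornerInvertible q (q * (a - z • 1) * q) := by
  have hz : z ∈ resolventSet ℂ (q * a * q) := spectrum.mem_resolventSet_of_norm_lt h
  obtain ⟨r, h1, h2⟩ := isUnit_iff_exists.1 (spectrum.mem_resolventSet_iff.1 hz)
  set N := algebraMap ℂ B z - q * a * q with hN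
  have e : q * (a - z • 1) * q = -(q * N) := by
    rw [hN, Algebra.algebraMap_eq_smul_one, mul_sub, mul_sub, sub_mul, ← mul_assoc, ← mul_assoc, hq]
    simp [hq]
  have hc : q * N = N * q := by
    rw [hN, Algebra.algebraMap_eq_smul_one, mul_sub, sub_mul, ← mul_assoc, ← mul_assoc,
      mul_assoc _ q q, hq]
    simp
  have hr : q * r = r * q := by
    calc q * r = (r * N) * q * r := by rw [h2, one_mul]
      _ = r * (N * q) * r := by simp only [mul_assoc]
      _ = r * q * (N * r) := by rw [← hc]; simp only [mul_assoc]
      _ = r * q := by rw [h1, mul_one]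
  refine ⟨-(q * r), ?_, ?_, ?_⟩
  · rw [mul_neg, neg_mul, ← mul_assoc, hq, mul_assoc, ← hr, ← mul_assoc, hq]
  · rw [e, neg_mul_neg]
    calc q * N * (q * r) = q * (N * q) * r := by simp only [mul_assoc]
      _ = (q * q) * (N * r) := by rw [← hc]; simp only [mul_assoc]
      _ = q := by rw [h1, hq, mul_one]
  · rw [e, neg_mul_neg]
    calc q * r * (q * N) = q * (r * q) * N := by simp only [mul_assoc]
      _ = (q * q) * (r * N) := by rw [← hr]; simp only [mul_assoc]
      _ = q := by rw [h2, hq, mul_one]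

/-- Here `p n` plays the role of `p_{n+1}` in the paper, so that
`∑ i ∈ Finset.range n, p i` is `P_n`: part (a) for the paper's index `n` reads with
`P_n = ∑ i ∈ Finset.range (n+1), p i` and part (b) with `P_{n-1} = ∑ i ∈ Finset.range n, p i`. -/
theorem cornerSpectrum_disjoint_and_proj_mem
    {B : Type*} [CStarAlgebra B] (a : B) (p : ℕ → B)
    (hsa : ∀ i, IsSelfAdjoint (p i)) (hidem : ∀ i, p i * p i = p i)
    (hne : ∀ i, p i ≠ 0)
    (horth : ∀ i i', i ≠ i' → p i * p i' = 0)
    (h1 : ∀ n : ℕ,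
      (1 - ∑ i ∈ Finset.range n, p i) * a * (∑ i ∈ Finset.range n, p i) = 0)
    (h2 : Filter.Tendsto
      (fun n : ℕ => ‖(1 - ∑ i ∈ Finset.range n, p i) * a * (1 - ∑ i ∈ Finset.range n, p i)‖)
      Filter.atTop (nhds 0))
    (h3 : ∀ i i', i ≠ i' →
      cornerSpectrum (p i) (p i * a * p i) ∩ cornerSpectrum (p i') (p i' * a * p i') = ∅)
    (h4 : ∀ i, cornerInvertible (p i) (p i * a * p i)) :
    ∀ n : ℕ,
      cornerSpectrum (p n) (p n * a * p n) ∩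
          cornerSpectrum (1 - ∑ i ∈ Finset.range (n + 1), p i)
            ((1 - ∑ i ∈ Finset.range (n + 1), p i) * a *
              (1 - ∑ i ∈ Finset.range (n + 1), p i)) = ∅ ∧
        p n ∈ cstarGen
          {(1 - ∑ i ∈ Finset.range n, p i) * a * (1 - ∑ i ∈ Finset.range n, p i)} := by

  have hnt : Nontrivial B := ⟨p 0, 0, hne 0⟩
  set P : ℕ → B := fun n => ∑ i ∈ Finset.range n, p i with hP
  have hPp : ∀ n k, P n * p k = if k < n then p k else 0 := by
    intro n k
    simp only [hP, Finset.sum_mul]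
    have : ∀ i ∈ Finset.range n, p i * p k = if i = k then p k else 0 := by
      intro i _
      split_ifs with h
      · rw [h, hidem]
      · exact horth i k h
    rw [Finset.sum_congr rfl this]
    simp
  have hpP : ∀ n k, p k * P n = if k < n then p k else 0 := by
    intro n k
    simp only [hP, Finset.mul_sum]
    have : ∀ i ∈ Finset.range n, p k * p i = if i = k then p k else 0 := by
      intro i _
      split_ifs with h
      · rw [h, hidem]
      · exact horth k i (Ne.symm h)
    rw [Finset.sum_congr rfl this]
    simp
  have hPP : ∀ n, P n * P n = P n := by
    intro n
    nth_rewrite 2 [hP]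
    simp only [Finset.mul_sum]
    refine Finset.sum_congr rfl fun i hi => ?_
    rw [hPp, if_pos (Finset.mem_range.1 hi)]
  set Q : ℕ → B := fun n => 1 - P n with hQ
  have hQQ : ∀ n, Q n * Q n = Q n := by
    intro n
    simp only [hQ, mul_sub, sub_mul, hPP]; simp
  have hQs : ∀ n, Q n = p n + Q (n + 1) := by
    intro n
    simp only [hQ, hP, Finset.sum_range_succ]; abel
  have hpQ : ∀ n, p n * Q n = p n := by
    intro n; simp only [hQ, mul_sub, hpP]; simp
  have hQp : ∀ n, Q n * p n = p n := by
    intro n; simp only [hQ, sub_mul, hPp]; simp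
  have hpQ' : ∀ n, p n * Q (n + 1) = 0 := by
    intro n; simp only [hQ, mul_sub, hpP]; simp
  have hQp' : ∀ n, Q (n + 1) * p n = 0 := by
    intro n; simp only [hQ, sub_mul, hPp]; simp
  have hQap : ∀ n, Q (n + 1) * a * p n = 0 := by
    intro n
    have h := congrArg (· * p n) (h1 (n + 1))
    have h' : Q (n + 1) * a * P (n + 1) * p n = 0 * p n := h
    rw [mul_assoc, hPp, if_pos (Nat.lt_succ_self n), zero_mul] at h'
    exact h'
  have hshift : ∀ (r : B) (z : ℂ), r * r = r → r * (a - z • 1) * r = r * a * r - z • r := by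
    intro r z hr
    rw [mul_sub, sub_mul]; simp [hr]
  have parta : ∀ n, cornerSpectrum (p n) (p n * a * p n) ∩
      cornerSpectrum (Q (n + 1)) (Q (n + 1) * a * Q (n + 1)) = ∅ := by
    intro n
    rw [Set.eq_empty_iff_forall_notMem]
    rintro z ⟨hz1, hz2⟩
    have hz0 : z ≠ 0 := by
      rintro rfl
      apply hz1
      rw [zero_smul, sub_zero]
      exact h4 n
    have hstep : ∀ k, n < k → cornerInvertible (Q (k + 1)) (Q (k + 1) * (a - z • 1) * Q (k + 1)) →
        cornerInvertible (Q k) (Q k * (a - z • 1) * Q k) := by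
      intro k hk hinv
      have hpk : cornerInvertible (p k) (p k * (a - z • 1) * p k) := by
        by_contra hcon
        rw [hshift _ _ (hidem k)] at hcon
        have : z ∈ cornerSpectrum (p n) (p n * a * p n) ∩ cornerSpectrum (p k) (p k * a * p k) :=
          ⟨hz1, hcon⟩
        rw [h3 n k hk.ne] at this
        exact this
      have hb := corner_block (p k) (Q (k + 1)) (a - z • 1) (hidem k) (hQQ _) (hpQ' k) (hQp' k)
        (by rw [mul_sub, sub_mul, hQap, mul_smul_comm, mul_one, smul_mul_assoc, hQp']; simp)
        hpk hinv
      rwa [← hQs] at hb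
    have hall : ∀ j, cornerInvertible (Q (n + 1 + j)) (Q (n + 1 + j) * (a - z • 1) * Q (n + 1 + j))
        → cornerInvertible (Q (n + 1)) (Q (n + 1) * (a - z • 1) * Q (n + 1)) := by
      intro j
      induction j with
      | zero => exact id
      | succ j ih => exact fun h => ih (hstep (n + 1 + j) (by omega) h)
    have hev : ∀ᶠ m in atTop, ‖Q m * a * Q m‖ < ‖z‖ :=
      h2.eventually (gt_mem_nhds (norm_pos_iff.2 hz0))
    obtain ⟨m, hm1, hm2⟩ := (hev.and (eventually_ge_atTop (n + 1))).exists
    obtain ⟨j, rfl⟩ := Nat.exists_eq_add_of_le hm2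
    have hfin := hall j (corner_of_norm _ a z (hQQ _) hm1)
    rw [hshift _ _ (hQQ _)] at hfin
    exact hz2 hfin
  intro n
  refine ⟨parta n, ?_⟩
  have e1 : p n * (Q n * a * Q n) * p n = p n * a * p n := by
    calc _ = (p n * Q n) * a * (Q n * p n) := by simp only [mul_assoc]
      _ = _ := by rw [hpQ, hQp]
  have f1 : (1 - p n) * Q n = Q (n + 1) := by
    rw [sub_mul, hpQ, hQs n]; simp
  have f2 : Q n * (1 - p n) = Q (n + 1) := by
    rw [mul_sub, hQp, hQs n]; simp
  have e2 : (1 - p n) * (Q n * a * Q n) * (1 - p n) = Q (n + 1) * a * Q (n + 1) := by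
    calc _ = ((1 - p n) * Q n) * a * (Q n * (1 - p n)) := by simp only [mul_assoc]
      _ = _ := by rw [f1, f2]
  have e3 : (1 - p n) * (Q n * a * Q n) * p n = 0 := by
    calc _ = ((1 - p n) * Q n) * a * (Q n * p n) := by simp only [mul_assoc]
      _ = _ := by rw [f1, hQp, hQap]
  set y := Q (n + 1) * a * Q (n + 1) with hy
  set l : ℂ := ((‖y‖ + 1 : ℝ) : ℂ) with hl
  have hln : ‖l‖ = ‖y‖ + 1 := by
    rw [hl, Complex.norm_real, Real.norm_of_nonneg (by positivity)]
  have hl0 : l ≠ 0 := by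
    rw [← norm_pos_iff, hln]; positivity
  have hpap : p n * (p n * a * p n) * p n = p n * a * p n := by
    calc _ = (p n * p n) * a * (p n * p n) := by simp only [mul_assoc]
      _ = _ := by rw [hidem]
  have hyy : Q (n + 1) * y * Q (n + 1) = y := by
    calc _ = (Q (n + 1) * Q (n + 1)) * a * (Q (n + 1) * Q (n + 1)) := by
          rw [hy]; simp only [mul_assoc]
      _ = _ := by rw [hQQ]
  refine proj_mem_s7 (NonUnitalStarAlgebra.adjoin ℂ {Q n * a * Q n}).topologicalClosure
    (NonUnitalStarSubalgebra.isClosed_topologicalClosure _) (Q n * a * Q n) (p n) l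
    (NonUnitalStarSubalgebra.le_topologicalClosure _
      (NonUnitalStarAlgebra.subset_adjoin ℂ _ (Set.mem_singleton _)))
    (hsa n) (hidem n) e3 ?_ ?_
  · rw [e1, e2, Set.disjoint_left]
    intro z hzx hzy
    have hzl : l ≠ z := by
      rintro rfl
      have := spectrum.norm_le_norm_of_mem hzy
      linarith
    have m1 : z ∈ cornerSpectrum (p n) (p n * a * p n) := fun hinv =>
      notMem_spectrum_of_corner _ _ z l (hidem n) hpap hzl hinv hzx
    have hz0 : (0 : ℂ) ≠ z := by
      rintro rfl
      apply m1
      rw [zero_smul, sub_zero]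
      exact h4 n
    have m2 : z ∈ cornerSpectrum (Q (n + 1)) y := fun hinv => by
      have := notMem_spectrum_of_corner _ _ z 0 (hQQ (n + 1)) hyy hz0 hinv
      rw [zero_smul, add_zero] at this
      exact this hzy
    have hmem : z ∈ cornerSpectrum (p n) (p n * a * p n) ∩ cornerSpectrum (Q (n + 1)) y := ⟨m1, m2⟩
    rw [parta n] at hmem
    exact hmem
  · rw [e1]
    refine notMem_spectrum_of_corner _ _ 0 l (hidem n) hpap hl0 ?_
    rw [zero_smul, sub_zero]
    exact h4 n
end

section
/- Let B be a unital C*-algebra containing a unital C*-subalgebra D and nonzero partial isometries v_1, …, v_n satisfying conditions (a)–(d). Let m be a positive integer with n > 2m − 1, and let d_1, …, d_m ∈ D \ {0} be self-adjoint elements. Then there exists an invertible element 𝔤 ∈ B such that d_1, …, d_m ∈ C*({𝔤}). -/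
theorem aux_reduce {B : Type*} [CStarAlgebra B] (x : B) :
    ∃ g : B, IsUnit g ∧ ∃ C : StarSubalgebra ℂ B, (C : Set B) = cstarGen {g} ∧ x ∈ C := by
  obtain ⟨ε, hε, hlt⟩ : ∃ ε : ℝ, 0 < ε ∧ ε * ‖x‖ < 1 := by
    refine ⟨(‖x‖ + 1)⁻¹, by positivity, ?_⟩
    rw [inv_mul_lt_iff₀ (by positivity)]
    linarith
  set y : B := -((ε : ℂ) • x) with hy
  have hyn : ‖y‖ < 1 := by
    rw [hy, norm_neg, norm_smul, Complex.norm_real, Real.norm_of_nonneg hε.le]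
    exact hlt
  let A : NonUnitalStarSubalgebra ℂ B := NonUnitalStarAlgebra.adjoin ℂ {1 - y}
  have hg : 1 - y ∈ A := NonUnitalStarAlgebra.subset_adjoin ℂ _ rfl
  have hpow : ∀ n : ℕ, 1 - y ^ n ∈ A := by
    intro n
    induction n with
    | zero => simp
    | succ n ih =>
      have : 1 - y ^ (n + 1) = (1 - y) + (1 - y ^ n) - (1 - y) * (1 - y ^ n) := by
        rw [pow_succ']; noncomm_ring
      rw [this]
      exact sub_mem (add_mem hg ih) (mul_mem hg ih)
  have h1 : (1 : B) ∈ A.topologicalClosure := by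
    have hlim : Filter.Tendsto (fun n : ℕ => 1 - y ^ n) Filter.atTop (nhds (1 - 0)) :=
      tendsto_const_nhds.sub (tendsto_pow_atTop_nhds_zero_of_norm_lt_one hyn)
    rw [sub_zero] at hlim
    exact mem_closure_of_tendsto hlim (Filter.Eventually.of_forall hpow)
  refine ⟨1 - y, isUnit_one_sub_of_norm_lt_one hyn,
    A.topologicalClosure.toStarSubalgebra h1, rfl, ?_⟩
  set C := A.topologicalClosure.toStarSubalgebra h1
  have hgC : 1 - y ∈ C := subset_closure hg
  have : x = ((ε : ℂ)⁻¹) • ((1 - y) - 1) := by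
    have : (ε : ℂ) ≠ 0 := by exact_mod_cast hε.ne'
    rw [hy]
    rw [sub_neg_eq_add, add_sub_cancel_left, smul_smul, inv_mul_cancel₀ this, one_smul]
  rw [this]
  exact C.smul_mem (sub_mem hgC (one_mem C)) _

theorem aux_sqrt {B : Type*} [CStarAlgebra B] [Nontrivial B] (C : StarSubalgebra ℂ B)
    (hC : IsClosed (C : Set B)) (d : B) (hd : IsSelfAdjoint d)
    (h : (d + algebraMap ℝ B ‖d‖) * (d + algebraMap ℝ B ‖d‖) ∈ C) : d ∈ C := by
  set r := d + algebraMap ℝ B ‖d‖ with hr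
  have hrs : IsSelfAdjoint r := hd.add (IsSelfAdjoint.algebraMap B (IsSelfAdjoint.all _))
  have hpos : ∀ t ∈ spectrum ℝ r, 0 ≤ t := by
    intro t ht
    have h2 : t - ‖d‖ ∈ spectrum ℝ d := by
      rw [← spectrum.add_mem_add_iff (s := ‖d‖), sub_add_cancel, add_comm]
      exact ht
    have := spectrum.norm_le_norm_of_mem h2
    rw [Real.norm_eq_abs, abs_le] at this
    linarith
  have h3 : cfc Real.sqrt (r ^ 2) = r := by
    rw [← cfc_comp_pow Real.sqrt 2 r]
    conv_rhs => rw [← cfc_id ℝ r]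
    exact cfc_congr fun t ht => Real.sqrt_sq (hpos t ht)
  have hrC : r ∈ C := by
    rw [← h3]
    have := hC
    exact cfc_mem (𝕜' := ℂ) _ (by rw [sq]; exact h)
  have : d = r - algebraMap ℂ B (‖d‖ : ℂ) := by
    rw [hr]
    have : algebraMap ℝ B ‖d‖ = algebraMap ℂ B (‖d‖ : ℂ) :=
      IsScalarTower.algebraMap_apply ℝ ℂ B _
    rw [this, add_sub_cancel_right]
  rw [this]
  exact sub_mem hrC (C.algebraMap_mem _)

theorem aux_proj {B : Type*} [CStarAlgebra B] (C : StarSubalgebra ℂ B) {n : ℕ}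
    (e : Fin n → B) (he : ∀ k l, e k * e l = if k = l then e k else 0) (h1 : ∑ k, e k = 1)
    (ha : ∑ k : Fin n, ((k : ℕ) : ℂ) • e k ∈ C) (k : Fin n) : e k ∈ C := by
  set a := ∑ k : Fin n, ((k : ℕ) : ℂ) • e k with hadef
  have hae : ∀ l : Fin n, a * e l = ((l : ℕ) : ℂ) • e l := by
    intro l
    simp [hadef, Finset.sum_mul, he]
  have hp : ∀ (p : Polynomial ℂ) (l : Fin n),
      Polynomial.aeval a p * e l = (p.eval ((l : ℕ) : ℂ)) • e l := by
    intro p l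
    induction p using Polynomial.induction_on with
    | C c => simp [Algebra.smul_def]
    | add p q hp hq => simp [add_mul, hp, hq, add_smul]
    | monomial m c ih =>
      rw [pow_succ, ← mul_assoc, map_mul, Polynomial.aeval_X, mul_assoc, hae, mul_smul_comm, ih,
        smul_smul, Polynomial.eval_mul (q := Polynomial.X), Polynomial.eval_X, mul_comm]
  have hinj : Set.InjOn (fun l : Fin n => ((l : ℕ) : ℂ)) (Finset.univ : Finset (Fin n)) := by
    intro x _ y _ hxy
    have hxy' : ((x : ℕ) : ℂ) = ((y : ℕ) : ℂ) := hxy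
    exact Fin.ext (by exact_mod_cast hxy')
  have h2 : Polynomial.aeval a
      (Lagrange.basis Finset.univ (fun l : Fin n => ((l : ℕ) : ℂ)) k) = e k := by
    rw [← mul_one (Polynomial.aeval a _), ← h1, Finset.mul_sum, Finset.sum_eq_single k]
    · rw [hp]
      have := Lagrange.eval_basis_self hinj (Finset.mem_univ k)
      rw [this, one_smul]
    · intro l _ hl
      rw [hp]
      have := Lagrange.eval_basis_of_ne (v := fun l : Fin n => ((l : ℕ) : ℂ)) (s := Finset.univ)
        hl.symm (Finset.mem_univ l)
      rw [this, zero_smul]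
    · simp
  rw [← h2]
  have hle : Algebra.adjoin ℂ {a} ≤ C.toSubalgebra :=
    Algebra.adjoin_le (Set.singleton_subset_iff.mpr ha)
  exact hle (Polynomial.aeval_mem_adjoin_singleton ℂ a)

/-- Matrix-unit computation. -/
theorem aux_matrix {B : Type*} [CStarAlgebra B] (C : StarSubalgebra ℂ B) {n : ℕ} [NeZero n]
    (E : Fin n → Fin n → B)
    (hE : ∀ i j k l, E i j * E k l = if j = k then E i l else 0)
    (hEs : ∀ i j, star (E i j) = E j i) (hE1 : ∑ k, E k k = 1)
    (hEC : ∀ k, E k k ∈ C)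
    {m : ℕ} (ι : Fin m → Fin n) (hι : Function.Injective ι)
    (hι0 : ∀ i j, ι i + ι j = 0 → ι i = 0 ∧ i = j)
    (h : Fin m → B) (hs : ∀ j, star (h j) = h j) (hh : ∀ j k, E k k * h j = h j * E k k)
    (hb : ∑ i, (h i * (∑ k, E k (k + ι i)) + star (∑ k, E k (k + ι i)) * h i) ∈ C)
    (j : Fin m) : h j * h j ∈ C := by
  classical
  set S : Fin n → B := fun t => ∑ k, E k (k + t) with hS
  have hSS : ∀ t, S t * star (S t) = 1 := by
    intro t
    simp [hS, Finset.sum_mul, Finset.mul_sum, hE, hEs, hE1]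
  have hS0 : S 0 = 1 := by simp [hS, hE1]
  have hES : ∀ k t, E k k * S t = E k (k + t) := by
    intro k t
    simp [hS, Finset.mul_sum, hE]
  have key : ∑ k, E k k * (∑ i, (h i * S (ι i) + star (S (ι i)) * h i)) * E (k + ι j) (k + ι j)
      = h j * S (ι j) + if ι j = 0 then h j else 0 := by
    have h1 : ∀ k i, E k k * (h i * S (ι i)) * E (k + ι j) (k + ι j)
        = if i = j then h j * E k (k + ι j) else 0 := by
      intro k i
      rw [← mul_assoc, hh, mul_assoc (h i), hES, mul_assoc, hE]
      simp only [add_right_inj, hι.eq_iff]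
      split_ifs with hij
      · rw [hij]
      · simp
    have h2 : ∀ k i, E k k * (star (S (ι i)) * h i) * E (k + ι j) (k + ι j)
        = if i = j then (if ι j = 0 then E k k * h j else 0) else 0 := by
      intro k i
      have h3 : E k k * star (S (ι i)) * E (k + ι j) (k + ι j)
          = if ι j + ι i = 0 then E k (k + ι j) else 0 := by
        have : E k k * star (S (ι i)) * E (k + ι j) (k + ι j)
            = star (E (k + ι j) (k + ι j) * S (ι i) * E k k) := by
          simp [hEs, mul_assoc]
        rw [this, hES, hE, add_assoc]
        simp only [add_eq_left]
        split_ifs <;> simp [hEs]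
      rw [← mul_assoc, mul_assoc, ← hh, ← mul_assoc, h3]
      by_cases h0 : ι j + ι i = 0
      · obtain ⟨hj0, hji⟩ := hι0 j i h0
        subst hji
        simp [hj0]
      · rw [if_neg h0, zero_mul]
        split_ifs with h4 h5
        · subst h4
          exact absurd (by rw [h5, add_zero]) h0
        · rfl
        · rfl
    simp only [Finset.mul_sum, Finset.sum_mul, mul_add, add_mul, h1, h2]
    simp only [Finset.sum_add_distrib, Finset.sum_ite_eq', Finset.mem_univ, if_true]
    congr 1
    · rw [← Finset.mul_sum]
    · split_ifs
      · rw [← Finset.sum_mul, hE1, one_mul]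
      · simp
  have hmem : h j * S (ι j) + (if ι j = 0 then h j else 0) ∈ C := by
    rw [← key]
    exact sum_mem fun k _ => mul_mem (mul_mem (hEC k) hb) (hEC _)
  by_cases h0 : ι j = 0
  · rw [h0, if_pos rfl, hS0, mul_one, ← two_smul ℂ] at hmem
    have : h j ∈ C := by
      have := C.smul_mem hmem (2⁻¹ : ℂ)
      rwa [smul_smul, inv_mul_cancel₀ two_ne_zero, one_smul] at this
    exact mul_mem this this
  · rw [if_neg h0, add_zero] at hmem
    have := mul_mem hmem (star_mem hmem)
    rwa [star_mul, hs, mul_assoc, ← mul_assoc (S _), hSS, one_mul] at this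

theorem exists_invertible_generating_selfAdjoints
    {B : Type*} [CStarAlgebra B] (D : StarSubalgebra ℂ B) (hDclosed : IsClosed (D : Set B))
    (n : ℕ) (hn : 0 < n) (v : Fin n → B)
    (hv_ne : ∀ k, v k ≠ 0)
    (hv_pi : ∀ k, v k * star (v k) * v k = v k)
    (ha : ∀ k, v ⟨0, hn⟩ = v k * star (v k))
    (hb₁ : ∀ k k', k ≠ k' → (star (v k) * v k) * (star (v k') * v k') = 0)
    (hb₂ : ∑ k, star (v k) * v k = 1)
    (hc : ∀ k, ∀ d ∈ D, (star (v k) * v k) * d = d * (star (v k) * v k))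
    (hd : ∀ k, ∀ d ∈ D, v k * d * star (v k) ∈ D)
    (m : ℕ) (hm : 0 < m) (hnm : 2 * m - 1 < n)
    (d : Fin m → B) (hd_mem : ∀ k, d k ∈ D) (hd_ne : ∀ k, d k ≠ 0)
    (hd_sa : ∀ k, IsSelfAdjoint (d k)) :
    ∃ g : B, IsUnit g ∧ ∀ k, d k ∈ cstarGen {g} := by
  classical
  have : NeZero n := ⟨hn.ne'⟩
  have : Nontrivial B := ⟨⟨_, _, hv_ne ⟨0, hn⟩⟩⟩
  let E : Fin n → Fin n → B := fun k l => star (v k) * v l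
  have hvs : ∀ k, star (v k) * v k * star (v k) = star (v k) := by
    intro k
    have := congrArg star (hv_pi k)
    simpa [mul_assoc] using this
  have hE : ∀ i j k l, E i j * E k l = if j = k then E i l else 0 := by
    intro i j k l
    simp only [E]
    split_ifs with hjk
    · subst hjk
      calc star (v i) * v j * (star (v j) * v l)
          = star (v i) * ((v j * star (v j)) * v l) := by simp only [mul_assoc]
        _ = star (v i) * v l := by rw [← ha j, ha l, hv_pi]
    · calc star (v i) * v j * (star (v k) * v l)
          = star (v i) * (v j * star (v j) * v j) * ((star (v k) * v k * star (v k)) * v l) := by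
            rw [hv_pi, hvs]
        _ = star (v i) * v j * ((star (v j) * v j) * (star (v k) * v k)) * (star (v k) * v l) := by
            simp only [mul_assoc]
        _ = 0 := by rw [hb₁ j k hjk]; simp
  have hEs : ∀ i j, star (E i j) = E j i := by
    intro i j
    simp [E]
  let ι : Fin m → Fin n := fun j => ⟨j, by omega⟩
  have hι : Function.Injective ι := by
    intro i j hij
    have h1 : (ι i : ℕ) = ι j := congrArg Fin.val hij
    exact Fin.ext h1
  have hι0 : ∀ i j, ι i + ι j = 0 → ι i = 0 ∧ i = j := by
    intro i j hij
    have h1 := congrArg Fin.val hij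
    rw [Fin.val_add] at h1
    have h2 : (i : ℕ) + j < n := by omega
    simp only [ι, Fin.val_zero, Nat.mod_eq_of_lt h2] at h1
    have hi : (i : ℕ) = 0 := by omega
    have hj : (j : ℕ) = 0 := by omega
    exact ⟨Fin.ext (by simp [ι, hi]), Fin.ext (by omega)⟩
  let h : Fin m → B := fun j => d j + algebraMap ℝ B ‖d j‖
  have hs : ∀ j, star (h j) = h j := fun j =>
    (hd_sa j).add (IsSelfAdjoint.algebraMap B (IsSelfAdjoint.all _))
  have hh : ∀ j k, E k k * h j = h j * E k k := by
    intro j k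
    simp only [h, mul_add, add_mul]
    rw [Algebra.commutes ‖d j‖ (E k k)]
    congr 1
    exact hc k _ (hd_mem j)
  let a : B := ∑ k : Fin n, ((k : ℕ) : ℂ) • E k k
  let b : B := ∑ i, (h i * (∑ k, E k (k + ι i)) + star (∑ k, E k (k + ι i)) * h i)
  have has : star a = a := by simp [a, hEs]
  have hbs : star b = b := by
    simp only [b, star_sum, star_add, star_mul, star_star, hs]
    simp only [add_comm]
  obtain ⟨g, hg, C, hC, hx⟩ := aux_reduce (a + Complex.I • b)
  refine ⟨g, hg, fun j => ?_⟩
  rw [← hC]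
  have hCc : IsClosed (C : Set B) := by rw [hC]; exact isClosed_closure
  have hxs : a - Complex.I • b ∈ C := by
    have := star_mem hx
    rw [star_add, star_smul, has, hbs] at this
    simpa [sub_eq_add_neg] using this
  have haC : a ∈ C := by
    have := C.smul_mem (add_mem hx hxs) (2⁻¹ : ℂ)
    rwa [add_add_sub_cancel, ← two_smul ℂ a, smul_smul, inv_mul_cancel₀ two_ne_zero,
      one_smul] at this
  have hbC : b ∈ C := by
    have := C.smul_mem (sub_mem hx haC) (-Complex.I)
    simpa [smul_smul] using this
  have hEC : ∀ k, E k k ∈ C := by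
    refine aux_proj C (fun k => E k k) (fun k l => ?_) hb₂ haC
    rw [hE]
    split_ifs with hkl
    · rw [hkl]
    · rfl
  exact aux_sqrt C hCc (d j) (hd_sa j)
    (aux_matrix C E hE hEs hb₂ hEC ι hι hι0 h hs hh hbC j)
end

section
/- Let B be a unital C*-algebra, let p_1, …, p_K be nonzero mutually orthogonal projections in B, and for each 1 ≤ j ≤ K let g_j ∈ p_j B p_j be invertible in the unital C*-algebra p_j B p_j, with σ_{p_j B p_j}(g_j) ∩ σ_{p_{j'} B p_{j'}}(g_{j'}) = ∅ for j ≠ j'. Set 𝔊 = Σ_{j=1}^{K} g_j. Then p_j ∈ C*({𝔊}) and g_j ∈ C*({𝔊}) for every 1 ≤ j ≤ K. -/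
/-- If `T` lies in the closed star subalgebra `A`, commutes with the projection `q` and is
invertible in the corner of `q`, then the corner inverse is `q * a` with `a ∈ A`. -/
theorem exists_corner_inv_aux {B : Type*} [CStarAlgebra B] (A : StarSubalgebra ℂ B)
    (hA : IsClosed (A : Set B)) (q T y : B) (hq : IsSelfAdjoint q) (hqq : q * q = q)
    (hT : T ∈ A) (hc : T * q = q * T) (hy : q * y = y) (hy' : y * q = y)
    (hTy : T * y = q) (hyT : y * T = q) :
    ∃ a ∈ A, q * (a * T) = q ∧ q * (T * a) = q := by
  have hq' : star q = q := hq
  have hcs : q * star T = star T * q := by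
    have := congrArg star hc
    simpa [hq'] using this
  set S := star T * T with hS
  have hSsa : IsSelfAdjoint S := IsSelfAdjoint.star_mul_self T
  have hSq : Commute S q := by
    show star T * T * q = q * (star T * T)
    rw [mul_assoc, hc, ← mul_assoc, ← hcs, mul_assoc]
  have hSA : S ∈ A := mul_mem (star_mem hT) hT
  set w := y * star y with hw
  have hwS : w * S = q := by
    have h1 : star y * star T = q := by rw [← star_mul, hTy, hq']
    calc w * S = y * (star y * star T) * T := by simp only [hw, hS, mul_assoc]
      _ = q := by rw [h1, hy', hyT]
  have hwq : w * q = w := by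
    have : star y * q = star y := by
      have := congrArg star hy
      simpa [hq'] using this
    rw [hw, mul_assoc, this]
  obtain ⟨ε, hε, hεw⟩ : ∃ ε : ℝ, 0 < ε ∧ ε * ‖w‖ < 1 := by
    refine ⟨(‖w‖ + 1)⁻¹, by positivity, ?_⟩
    rw [inv_mul_lt_iff₀ (by positivity)]
    linarith
  let f : ℝ → ℝ := fun t => (max t ε)⁻¹
  have hpos : ∀ t : ℝ, 0 < max t ε := fun t => lt_max_of_lt_right hε
  have hf : Continuous f := by
    apply Continuous.inv₀ (by fun_prop)
    intro t
    exact (hpos t).ne'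
  set F := cfc f S with hF
  have hFA : F ∈ A := by
    have := hA
    exact cfc_mem (𝕜' := ℂ) f hSA
  have hFq : Commute F q := hSq.cfc_real f
  have hSF : S * F = cfc (fun t => t * f t) S := by
    rw [cfc_mul (fun t => t) f S (by fun_prop) hf.continuousOn, cfc_id' ℝ S]
  have hSFn : ‖S * F‖ ≤ 1 := by
    rw [hSF]
    apply norm_cfc_le zero_le_one
    intro t ht
    have ht0 : 0 ≤ t := spectrum_star_mul_self_nonneg t ht
    have : 0 ≤ t * f t := mul_nonneg ht0 (inv_nonneg.2 (hpos t).le)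
    rw [Real.norm_of_nonneg this]
    show t * (max t ε)⁻¹ ≤ 1
    rw [mul_inv_le_iff₀ (hpos t), one_mul]
    exact le_max_left _ _
  have hFS : F * S = S * F := (Commute.cfc_real (Commute.refl S) f : Commute F S)
  have hprod : (1 - S * F) = ε • (F * (1 - S * F)) := by
    have e1 : 1 - S * F = cfc (fun t => 1 - t * f t) S := by
      rw [cfc_sub (fun _ => (1:ℝ)) (fun t => t * f t) S (by fun_prop) (by fun_prop),
        cfc_const_one ℝ S, hSF]
    rw [e1, hF, ← cfc_mul f _ S (by fun_prop) (by fun_prop), ← cfc_smul ε _ S (by fun_prop)]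
    congr 1
    funext t
    show 1 - t * (max t ε)⁻¹ = ε • ((max t ε)⁻¹ * (1 - t * (max t ε)⁻¹))
    rcases le_total t ε with h | h
    · rw [max_eq_right h, smul_eq_mul, mul_inv_cancel_left₀ hε.ne']
    · rw [max_eq_left h, mul_inv_cancel₀ (by linarith)]
      simp
  set x := q * (1 - S * F) with hx
  have hxx : x = ε • (w * (S * F) * x) := by
    have h1 : w * (S * F) * x = w * S * (F * (1 - S * F)) := by
      have h2 : S * F * q = q * (S * F) := hSq.mul_left hFq
      calc w * (S * F) * x = w * (S * F * q) * (1 - S * F) := by simp only [hx, mul_assoc]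
        _ = w * q * (S * F) * (1 - S * F) := by rw [h2]; simp only [mul_assoc]
        _ = _ := by rw [hwq]; simp only [mul_assoc]
    rw [h1, hwS, ← mul_smul_comm, ← hprod]
  have hx0 : x = 0 := by
    have h1 : ‖x‖ ≤ ε * ‖w‖ * ‖x‖ := by
      calc ‖x‖ = ‖ε • (w * (S * F) * x)‖ := by rw [← hxx]
        _ = ε * ‖w * (S * F) * x‖ := by rw [norm_smul, Real.norm_of_nonneg hε.le]
        _ ≤ ε * (‖w‖ * 1 * ‖x‖) := by
          gcongr
          refine (norm_mul_le _ _).trans ?_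
          gcongr
          refine (norm_mul_le _ _).trans ?_
          gcongr
        _ = _ := by ring
    by_contra h
    have : 0 < ‖x‖ := norm_pos_iff.2 h
    nlinarith
  have hqSF : q * (S * F) = q := by
    have : q - q * (S * F) = 0 := by rw [← hx0, hx, mul_sub, mul_one]
    exact (sub_eq_zero.1 this).symm
  have haT : q * (F * star T * T) = q := by
    rw [mul_assoc F, ← hS, hFS, hqSF]
  have hqa : q * (F * star T) = y := by
    have h1 : q * (F * star T) = q * (F * star T) * q := by
      rw [mul_assoc, mul_assoc F, ← hcs, ← mul_assoc F, hFq.eq, ← mul_assoc, ← mul_assoc,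
        ← mul_assoc, hqq]
    calc q * (F * star T) = q * (F * star T) * (T * y) := by rw [hTy, ← h1]
      _ = q * (F * star T * T) * y := by simp only [mul_assoc]
      _ = y := by rw [haT, hy]
  refine ⟨F * star T, mul_mem hFA (star_mem hT), haT, ?_⟩
  rw [← mul_assoc, ← hc, mul_assoc, hqa, hTy]

/-- Key step: the quotient of `A` by the ideal of those `x` with `q * x ∈ A` must vanish,
since otherwise `T` would have empty spectrum there. -/
theorem proj_mem_aux {B : Type*} [CStarAlgebra B] (A : StarSubalgebra ℂ B)
    (hA : IsClosed (A : Set B)) (q T : B) (hT : T ∈ A) (hcomm : ∀ a ∈ A, a * q = q * a)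
    (h : ∀ z : ℂ, ∃ a ∈ A,
      (q * (a * (T - z • 1)) = q ∧ q * ((T - z • 1) * a) = q) ∨
      ((1 - q) * (a * (T - z • 1)) = 1 - q ∧ (1 - q) * ((T - z • 1) * a) = 1 - q)) :
    q ∈ A := by
  by_contra hqA
  have : CompleteSpace A := hA.completeSpace_coe
  let J : Submodule ℂ A :=
    { carrier := {x | q * (x : B) ∈ A}
      add_mem' := by
        intro a b ha hb
        simpa [mul_add] using add_mem ha hb
      zero_mem' := by simp
      smul_mem' := by
        intro c x hx
        simpa using A.smul_mem hx c }
  have hJmem : ∀ x : A, x ∈ J ↔ q * (x : B) ∈ A := fun x => Iff.rfl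
  have hJc : IsClosed (J : Set A) :=
    hA.preimage (f := fun x : A => q * (x : B)) (by fun_prop)
  have hL : ∀ (a x : A), x ∈ J → a * x ∈ J := by
    intro a x hx
    rw [hJmem] at *
    have : q * ((a * x : A) : B) = a * (q * x) := by
      push_cast
      rw [← mul_assoc, ← hcomm _ a.2, mul_assoc]
    rw [this]
    exact mul_mem a.2 hx
  have hR : ∀ (a x : A), x ∈ J → x * a ∈ J := by
    intro a x hx
    rw [hJmem] at *
    have : q * ((x * a : A) : B) = (q * x) * a := by
      push_cast
      rw [← mul_assoc]
    rw [this]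
    exact mul_mem hx a.2
  let L : A → ((A ⧸ J) →L[ℂ] (A ⧸ J)) := fun a =>
    J.liftQL (J.mkQL ∘L ContinuousLinearMap.mul ℂ A a) (by
      intro x hx
      have := hL a x hx
      simpa using this)
  have hLmk : ∀ a x : A, L a (J.mkQ x) = J.mkQ (a * x) := fun a x => rfl
  have hLmul : ∀ a b : A, L a * L b = L (a * b) := by
    intro a b
    ext v
    obtain ⟨x, rfl⟩ := J.mkQ_surjective v
    rw [mul_apply_eq_comp, hLmk, hLmk, hLmk, mul_assoc]
  have hL1 : ∀ a : A, a - 1 ∈ J → L a = 1 := by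
    intro a ha
    ext v
    obtain ⟨x, rfl⟩ := J.mkQ_surjective v
    rw [hLmk]
    show J.mkQ (a * x) = J.mkQ x
    rw [← sub_eq_zero, ← map_sub]
    have := hR x _ ha
    rw [sub_mul, one_mul] at this
    exact (Submodule.Quotient.mk_eq_zero J).2 this
  have : Nontrivial (A ⧸ J) := by
    refine ⟨J.mkQ 1, 0, ?_⟩
    intro h0
    have : (1 : A) ∈ J := by simpa using h0
    rw [hJmem] at this
    exact hqA (by simpa using this)
  obtain ⟨z, hz⟩ := spectrum.nonempty (L ⟨T, hT⟩)
  apply hz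
  obtain ⟨a, ha, hza⟩ := h z
  let Tz : A := ⟨T, hT⟩ - z • 1
  let a' : A := ⟨a, ha⟩
  have hLT : L Tz = L ⟨T, hT⟩ - algebraMap ℂ _ z := by
    ext v
    obtain ⟨x, rfl⟩ := J.mkQ_surjective v
    rw [hLmk]
    simp only [Tz, sub_mul, map_sub, smul_mul_assoc, one_mul, map_smul]
    rfl
  have hJ : a' * Tz - 1 ∈ J ∧ Tz * a' - 1 ∈ J := by
    have c1 : ((a' * Tz - 1 : A) : B) = a * (T - z • 1) - 1 := rfl
    have c2 : ((Tz * a' - 1 : A) : B) = (T - z • 1) * a - 1 := rfl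
    rcases hza with ⟨h1, h2⟩ | ⟨h1, h2⟩
    · rw [hJmem, hJmem, c1, c2, mul_sub q _ 1, mul_sub q _ 1, h1, h2]
      simp
    · have k : ∀ x : B, (1 - q) * x = 1 - q → q * (x - 1) = x - 1 := by
        intro x hx
        have : x - q * x = 1 - q := by rw [← hx, sub_mul, one_mul]
        rw [mul_sub, mul_one]
        rw [sub_eq_sub_iff_add_eq_add] at this ⊢
        rw [this, add_comm]
      rw [hJmem, hJmem, c1, c2, k _ h1, k _ h2, ← c1, ← c2]
      exact ⟨Subtype.property _, Subtype.property _⟩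
  have u1 : L a' * L Tz = 1 := by rw [hLmul, hL1 _ hJ.1]
  have u2 : L Tz * L a' = 1 := by rw [hLmul, hL1 _ hJ.2]
  have hu : IsUnit (L Tz) := ⟨⟨L Tz, L a', u2, u1⟩, rfl⟩
  rw [hLT] at hu
  rw [spectrum.mem_resolventSet_iff, ← neg_sub]
  exact hu.neg

/-- Multiplying an element of the unital C*-algebra generated by `G` by `G` lands in the
nonunital one. -/
theorem mul_mem_cstarGen_aux {B : Type*} [CStarAlgebra B] (G a : B)
    (ha : a ∈ StarAlgebra.elemental ℂ G) : a * G ∈ cstarGen {G} := by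
  let N : NonUnitalStarSubalgebra ℂ B := (NonUnitalStarAlgebra.adjoin ℂ {G}).topologicalClosure
  have hN : ∀ x, x ∈ N ↔ x ∈ cstarGen {G} := fun x => Iff.rfl
  have hNc : IsClosed (N : Set B) := isClosed_closure
  have hG : G ∈ N := subset_closure (NonUnitalStarAlgebra.subset_adjoin ℂ {G} rfl)
  have key : ∀ x ∈ N, a * x ∈ N := by
    induction ha using StarAlgebra.elemental.induction_on with
    | self => exact fun x hx => mul_mem hG hx
    | star_self => exact fun x hx => mul_mem (star_mem hG) hx
    | algebraMap r =>
      intro x hx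
      rw [← Algebra.smul_def]
      exact SMulMemClass.smul_mem r hx
    | add u hu v hv h1 h2 =>
      intro x hx
      rw [add_mul]
      exact add_mem (h1 x hx) (h2 x hx)
    | mul u hu v hv h1 h2 =>
      intro x hx
      rw [mul_assoc]
      exact h1 _ (h2 x hx)
    | closure s hs h v hv =>
      intro x hx
      have hc : IsClosed {u : B | u * x ∈ N} :=
        hNc.preimage (f := fun u : B => u * x) (by fun_prop)
      exact closure_minimal (fun u hu => h u hu x hx) hc hv
  exact (hN _).1 (key G hG)

theorem proj_and_corner_elements_mem_cstarGen_sum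
    {B : Type*} [CStarAlgebra B] (K : ℕ) (p : Fin K → B) (g : Fin K → B)
    (hsa : ∀ j, IsSelfAdjoint (p j)) (hidem : ∀ j, p j * p j = p j)
    (hne : ∀ j, p j ≠ 0)
    (horth : ∀ j j', j ≠ j' → p j * p j' = 0)
    (hg_corner : ∀ j, p j * g j * p j = g j)
    (hg_inv : ∀ j, cornerInvertible (p j) (g j))
    (hspec : ∀ j j', j ≠ j' → cornerSpectrum (p j) (g j) ∩ cornerSpectrum (p j') (g j') = ∅) :
    ∀ j, p j ∈ cstarGen {∑ j', g j'} ∧ g j ∈ cstarGen {∑ j', g j'} := by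
  intro j
  have cl : ∀ i (x : B), p i * x * p i = x → p i * x = x := by
    intro i x hx
    rw [← hx, ← mul_assoc, ← mul_assoc, hidem]
  have cr : ∀ i (x : B), p i * x * p i = x → x * p i = x := by
    intro i x hx
    rw [← hx, mul_assoc, hidem]
  set G := ∑ j', g j' with hG
  have hpG : ∀ i, p i * G = g i := by
    intro i
    rw [hG, Finset.mul_sum, Finset.sum_eq_single i]
    · exact cl i _ (hg_corner i)
    · intro k _ hk
      rw [← cl k _ (hg_corner k), ← mul_assoc, horth i k hk.symm, zero_mul]
    · simp
  have hGp : ∀ i, G * p i = g i := by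
    intro i
    rw [hG, Finset.sum_mul, Finset.sum_eq_single i]
    · exact cr i _ (hg_corner i)
    · intro k _ hk
      rw [← cr k _ (hg_corner k), mul_assoc, horth k i hk, mul_zero]
    · simp
  let A := StarAlgebra.elemental ℂ G
  have hAc : IsClosed (A : Set B) := StarAlgebra.elemental.isClosed ℂ G
  have hGA : G ∈ A := StarAlgebra.elemental.self_mem ℂ G
  have hcomm : ∀ a ∈ A, a * p j = p j * a := by
    have hle : A ≤ StarSubalgebra.centralizer ℂ {p j} := by
      apply StarAlgebra.elemental.le_of_mem
      · rw [StarSubalgebra.coe_centralizer]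
        exact Set.isClosed_centralizer _
      · rw [StarSubalgebra.mem_centralizer_iff]
        have h1 : p j * G = G * p j := by rw [hpG, hGp]
        intro x hx
        rw [Set.mem_singleton_iff] at hx
        subst hx
        rw [(hsa j).star_eq]
        exact ⟨h1, h1⟩
    intro a ha
    have := hle ha
    rw [StarSubalgebra.mem_centralizer_iff] at this
    exact ((this (p j) rfl).1).symm
  have hTzA : ∀ z : ℂ, G - z • 1 ∈ A := fun z => sub_mem hGA (A.smul_mem (one_mem _) z)
  have hTp : ∀ (z : ℂ) i, (G - z • 1) * p i = g i - z • p i := by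
    intro z i
    rw [sub_mul, hGp, smul_mul_assoc, one_mul]
  have hpT : ∀ (z : ℂ) i, p i * (G - z • 1) = g i - z • p i := by
    intro z i
    rw [mul_sub, hpG, mul_smul_comm, mul_one]
  have hinv1 : ∀ (z : ℂ) i (y : B), p i * y * p i = y → (g i - z • p i) * y = p i →
      y * (g i - z • p i) = p i → (G - z • 1) * y = p i ∧ y * (G - z • 1) = p i := by
    intro z i y h1 h2 h3
    constructor
    · rw [← cl i y h1, ← mul_assoc, hTp, h2]
    · rw [← cr i y h1, mul_assoc, hpT, h3]
  have hcase1 : ∀ z : ℂ, cornerInvertible (p j) (g j - z • p j) →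
      ∃ a ∈ A, p j * (a * (G - z • 1)) = p j ∧ p j * ((G - z • 1) * a) = p j := by
    rintro z ⟨y, h1, h2, h3⟩
    obtain ⟨h4, h5⟩ := hinv1 z j y h1 h2 h3
    exact exists_corner_inv_aux A hAc (p j) _ y (hsa j) (hidem j) (hTzA z)
      (hcomm _ (hTzA z)) (cl j y h1) (cr j y h1) h4 h5
  have hpA : p j ∈ A := by
    apply proj_mem_aux A hAc (p j) G hGA hcomm
    intro z
    by_cases hz : cornerInvertible (p j) (g j - z • p j)
    · obtain ⟨a, ha, h⟩ := hcase1 z hz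
      exact ⟨a, ha, Or.inl h⟩
    have hz0 : z ≠ 0 := by
      rintro rfl
      apply hz
      simpa using hg_inv j
    have hoth : ∀ i, ∃ y : B, p j * y = 0 ∧ y * p j = 0 ∧
        (G - z • 1) * y = (if i = j then 0 else p i) ∧
        y * (G - z • 1) = (if i = j then 0 else p i) := by
      intro i
      by_cases hi : i = j
      · exact ⟨0, by simp [hi]⟩
      · have : cornerInvertible (p i) (g i - z • p i) := by
          by_contra hcon
          have hmem : z ∈ cornerSpectrum (p i) (g i) ∩ cornerSpectrum (p j) (g j) := ⟨hcon, hz⟩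
          rw [hspec i j hi] at hmem
          exact hmem
        obtain ⟨y, h1, h2, h3⟩ := this
        obtain ⟨h4, h5⟩ := hinv1 z i y h1 h2 h3
        refine ⟨y, ?_, ?_, ?_, ?_⟩
        · rw [← cl i y h1, ← mul_assoc, horth j i (Ne.symm hi), zero_mul]
        · rw [← cr i y h1, mul_assoc, horth i j hi, mul_zero]
        · rw [if_neg hi, h4]
        · rw [if_neg hi, h5]
    choose y hy1 hy2 hy3 hy4 using hoth
    set P := ∑ i, p i with hP
    have hpP : p j * P = p j := by
      rw [hP, Finset.mul_sum, Finset.sum_eq_single j]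
      · exact hidem j
      · intro k _ hk
        exact horth j k hk.symm
      · simp
    have hPp : P * p j = p j := by
      rw [hP, Finset.sum_mul, Finset.sum_eq_single j]
      · exact hidem j
      · intro k _ hk
        exact horth k j hk
      · simp
    have hGP : G * P = G := by
      rw [hP, Finset.mul_sum, hG]
      exact Finset.sum_congr rfl fun i _ => hGp i
    have hPG : P * G = G := by
      rw [hP, Finset.sum_mul, hG]
      exact Finset.sum_congr rfl fun i _ => hpG i
    have hsum : ∑ i, (if i = j then 0 else p i) = P - p j := by
      rw [eq_sub_iff_add_eq, hP]
      have : p j = ∑ i, if i = j then p i else 0 := by simp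
      rw [this, ← Finset.sum_add_distrib]
      refine Finset.sum_congr rfl fun i _ => ?_
      split_ifs <;> simp
    let Y : B := ∑ i, y i - z⁻¹ • (1 - P)
    have hpY : p j * Y = 0 := by
      simp only [Y, mul_sub, Finset.mul_sum, hy1, mul_smul_comm, mul_one, hpP]
      simp
    have hYp : Y * p j = 0 := by
      simp only [Y, sub_mul, Finset.sum_mul, hy2, smul_mul_assoc, one_mul, hPp]
      simp
    have hTY : (G - z • 1) * Y = 1 - p j := by
      have e : (G - z • 1) * (1 - P) = -(z • (1 - P)) := by
        rw [sub_mul, mul_sub, hGP, mul_one, sub_self, zero_sub, smul_mul_assoc, one_mul]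
      simp only [Y]
      rw [mul_sub, Finset.mul_sum, Finset.sum_congr rfl (fun i _ => hy3 i), hsum,
        mul_smul_comm, e, smul_neg, inv_smul_smul₀ hz0]
      abel
    have hYT : Y * (G - z • 1) = 1 - p j := by
      have e : (1 - P) * (G - z • 1) = -(z • (1 - P)) := by
        rw [mul_sub, sub_mul, hPG, one_mul, sub_self, zero_sub, mul_smul_comm, mul_one]
      simp only [Y]
      rw [sub_mul, Finset.sum_mul, Finset.sum_congr rfl (fun i _ => hy4 i), hsum,
        smul_mul_assoc, e, smul_neg, inv_smul_smul₀ hz0]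
      abel
    obtain ⟨a, ha, h⟩ := exists_corner_inv_aux A hAc (1 - p j) (G - z • 1) Y
      ((IsSelfAdjoint.one B).sub (hsa j)) (by simp [mul_sub, sub_mul, hidem]) (hTzA z)
      (by rw [mul_sub, sub_mul 1 (p j), mul_one, one_mul, hcomm _ (hTzA z)])
      (by rw [sub_mul, hpY, one_mul, sub_zero]) (by rw [mul_sub, hYp, mul_one, sub_zero])
      hTY hYT
    exact ⟨a, ha, Or.inr h⟩
  obtain ⟨a, ha, h1, -⟩ := hcase1 0 (by simpa using hg_inv j)
  constructor
  · have := mul_mem_cstarGen_aux G (p j * a) (mul_mem hpA ha)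
    rw [zero_smul, sub_zero, ← mul_assoc] at h1
    rwa [h1] at this
  · have := mul_mem_cstarGen_aux G (p j) hpA
    rwa [hpG] at this
end
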